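/- arXiv:1307.0873 — 15 statements merged into one kernel-verified Lean document; each statement's English description precedes it below -/
import Mathlib

section
/- Let {λ_k}, {λ̃_k}, {B^w_k}, {G_k}, {B_k} be a Frank–Wolfe iterate sequence with step sizes {ᾱ_k} ⊆ [0,1), let C ≥ 0 be a curvature bound for (h,Q), and let {α_k}, {β_k} be the associated dual-averages sequences. Then for every k ≥ 0: B_k − h(λ_{k+1}) ≤ (B_k − h(λ_1))/β_{k+1} + ( (C/2) · Σ_{i=1}^{k} α_i²/β_{i+1} ) / β_{k+1}. -/
/-- Frank–Wolfe iterates stay in the convex feasible set. -/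
theorem frank_wolfe_iterate_mem {E : Type*} [AddCommGroup E] [Module ℝ E] {Q : Set E}
    (hQ : Convex ℝ Q) {a : ℕ → ℝ} {x y : ℕ → E} (ha : ∀ k, 1 ≤ k → a k ∈ Set.Ico (0 : ℝ) 1)
    (hx : x 1 ∈ Q) (hy : ∀ k, 1 ≤ k → y k ∈ Q)
    (hnext : ∀ k, 1 ≤ k → x (k + 1) = x k + a k • (y k - x k)) {k : ℕ} (hk : 1 ≤ k) :
    x k ∈ Q := by
  induction k, hk using Nat.le_induction with
  | base => exact hx
  | succ k hk ih =>
    rw [hnext k hk]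
    exact hQ.add_smul_sub_mem ih (hy k hk) ⟨(ha k hk).1, (ha k hk).2.le⟩

/-- Unrolling a contraction-type recursion for upper bounds, with dual-averages weights. -/
theorem bound_gap_le_of_recursion {a alpha beta B H : ℕ → ℝ} {c : ℝ}
    (ha : ∀ k, 1 ≤ k → a k ∈ Set.Ico (0 : ℝ) 1)
    (hB : ∀ k, 1 ≤ k → B k ≤ B (k - 1))
    (hrec : ∀ k, 1 ≤ k → (1 - a k) * H k + a k * B k - c * a k ^ 2 ≤ H (k + 1))
    (hbeta : ∀ k, 1 ≤ k → beta k = (∏ j ∈ Finset.Icc 1 (k - 1), (1 - a j))⁻¹)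
    (halpha : ∀ k, 1 ≤ k → alpha k = beta k * a k / (1 - a k))
    (k : ℕ) {x : ℝ} (hx : x ≤ B k) :
    x - H (k + 1) ≤ (x - H 1) / beta (k + 1)
      + (c * ∑ i ∈ Finset.Icc 1 k, alpha i ^ 2 / beta (i + 1)) / beta (k + 1) := by
  induction k with
  | zero => simp [hbeta 1 le_rfl]
  | succ k ih =>
    have hk : 1 ≤ k + 1 := Nat.le_add_left 1 k
    have hpos : 0 < 1 - a (k + 1) := sub_pos.2 (ha _ hk).2
    have hb : 0 < beta (k + 1) := by
      rw [hbeta _ hk]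
      exact inv_pos.2 (Finset.prod_pos fun j hj => sub_pos.2 (ha j (Finset.mem_Icc.1 hj).1).2)
    have hbs : beta (k + 1 + 1) = beta (k + 1) / (1 - a (k + 1)) := by
      rw [hbeta _ hk, hbeta _ (Nat.le_add_left 1 _), Nat.add_sub_cancel, Nat.add_sub_cancel,
        Finset.prod_Icc_succ_top hk, mul_inv, div_eq_mul_inv]
    have hstep : x - H (k + 1 + 1) ≤ (1 - a (k + 1)) * (x - H (k + 1)) + c * a (k + 1) ^ 2 := by
      linarith [hrec _ hk, mul_le_mul_of_nonneg_left hx (ha _ hk).1]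
    refine hstep.trans ?_
    grw [ih (hx.trans (hB _ hk))]
    rw [Finset.sum_Icc_succ_top hk, halpha _ hk, hbs]
    apply le_of_eq
    field_simp
    ring


theorem frank_wolfe_bound_gap_general_stepsizes
    {E : Type*} [NormedAddCommGroup E] [NormedSpace ℝ E] [FiniteDimensional ℝ E]
    (Q : Set E) (hQne : Q.Nonempty) (hQcomp : IsCompact Q) (hQconv : Convex ℝ Q)
    (U : Set E) (hUopen : IsOpen U) (hQU : Q ⊆ U)
    (h : E → ℝ) (hconc : ConcaveOn ℝ Set.univ h) (hdiff : DifferentiableOn ℝ h U)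
    (hstar : ℝ) (hhstar : IsGreatest (h '' Q) hstar)
    (C : ℝ) (hC : 0 ≤ C)
    (hcurv : ∀ lam ∈ Q, ∀ lam' ∈ Q, ∀ a ∈ Set.Icc (0:ℝ) 1,
      h (lam + a • (lam' - lam)) ≥
        h lam + a * (fderiv ℝ h lam) (lam' - lam) - C / 2 * a ^ 2)
    (ab : ℕ → ℝ) (lam lamt : ℕ → E) (Bw G B : ℕ → ℝ)
    (hab : ∀ k, 1 ≤ k → ab k ∈ Set.Ico (0:ℝ) 1)
    (hlam1 : lam 1 ∈ Q)
    (hlamtQ : ∀ k, 1 ≤ k → lamt k ∈ Q)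
    (hargmax : ∀ k, 1 ≤ k → ∀ l ∈ Q,
      (fderiv ℝ h (lam k)) (l - lam k) ≤ (fderiv ℝ h (lam k)) (lamt k - lam k))
    (hBw : ∀ k, 1 ≤ k → Bw k = h (lam k) + (fderiv ℝ h (lam k)) (lamt k - lam k))
    (hG : ∀ k, 1 ≤ k → G k = (fderiv ℝ h (lam k)) (lamt k - lam k))
    (hnext : ∀ k, 1 ≤ k → lam (k+1) = lam k + ab k • (lamt k - lam k))
    (hBlb : ∀ k, hstar ≤ B k)
    (hBmono : ∀ k, 1 ≤ k → B k ≤ B (k-1))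
    (hBBw : ∀ k, 1 ≤ k → B k ≤ Bw k)
    (alpha beta : ℕ → ℝ)
    (hbeta : ∀ k, 1 ≤ k → beta k = (∏ j ∈ Finset.Icc 1 (k-1), (1 - ab j))⁻¹)
    (halpha : ∀ k, 1 ≤ k → alpha k = beta k * ab k / (1 - ab k))
    :
    ∀ k : ℕ, B k - h (lam (k+1)) ≤ (B k - h (lam 1)) / beta (k+1)
      + (C / 2 * ∑ i ∈ Finset.Icc 1 k, alpha i ^ 2 / beta (i+1)) / beta (k+1) := by
  have hmem : ∀ k, 1 ≤ k → lam k ∈ Q := fun k hk =>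
    frank_wolfe_iterate_mem hQconv hab hlam1 hlamtQ hnext hk
  refine fun k => bound_gap_le_of_recursion (H := fun j => h (lam j)) (c := C / 2)
    hab hBmono (fun j hj => ?_) hbeta halpha k le_rfl
  have hc := hcurv _ (hmem j hj) _ (hlamtQ j hj) _ ⟨(hab j hj).1, (hab j hj).2.le⟩
  rw [← hnext j hj] at hc
  have hw := mul_le_mul_of_nonneg_left ((hBBw j hj).trans_eq (hBw j hj)) (hab j hj).1
  linarith
end

section
/- Let {λ_k}, {λ̃_k}, {B^w_k}, {G_k}, {B_k} be a Frank–Wolfe iterate sequence with step sizes {ᾱ_k} ⊆ [0,1), let C ≥ 0 be a curvature bound for (h,Q), and let {α_k}, {β_k} be the associated dual-averages sequences. Then for every ℓ ≥ 0 and every k ≥ ℓ + 1 with Σ_{i=ℓ+1}^{k} ᾱ_i > 0: min_{i∈{ℓ+1,…,k}} G_i ≤ (1/Σ_{i=ℓ+1}^{k} ᾱ_i) · [ (B_ℓ − h(λ_1))/β_{ℓ+1} + ( (C/2) · Σ_{i=1}^{ℓ} α_i²/β_{i+1} ) / β_{ℓ+1} ] + ( (C/2) · Σ_{i=ℓ+1}^{k}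 ᾱ_i² ) / ( Σ_{i=ℓ+1}^{k} ᾱ_i ). -/
/-- Telescoping a one-step lower bound on the increments of `f`. -/
lemma sum_Icc_mul_le_of_step {f a g : ℕ → ℝ} {c : ℝ} {l k : ℕ} (hlk : l ≤ k)
    (hstep : ∀ i, l + 1 ≤ i → f i + a i * g i - c * a i ^ 2 ≤ f (i + 1)) :
    ∑ i ∈ Finset.Icc (l + 1) k, a i * g i ≤
      f (k + 1) - f (l + 1) + c * ∑ i ∈ Finset.Icc (l + 1) k, a i ^ 2 := by
  induction k, hlk using Nat.le_induction with
  | base => simp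
  | succ k hk ih =>
    rw [Finset.sum_Icc_succ_top (by lia), Finset.sum_Icc_succ_top (by lia)]
    linarith [hstep (k + 1) (by lia)]

/-- Unrolling the contraction `d (i + 1) ≤ (1 - a i) * d i + c * a i ^ 2` with the
dual-averages weights. -/
lemma mul_le_add_sum_of_contraction {d a α β : ℕ → ℝ} {c : ℝ} {l : ℕ}
    (ha : ∀ i, 1 ≤ i → a i < 1) (hβ : ∀ i, 1 ≤ i → 0 < β i)
    (hβsucc : ∀ i, 1 ≤ i → β i = β (i + 1) * (1 - a i))
    (hα : ∀ i, 1 ≤ i → α i = β i * a i / (1 - a i))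
    (hd : ∀ i, 1 ≤ i → i ≤ l → d (i + 1) ≤ (1 - a i) * d i + c * a i ^ 2) :
    β (l + 1) * d (l + 1) ≤
      β 1 * d 1 + c * ∑ i ∈ Finset.Icc 1 l, α i ^ 2 / β (i + 1) := by
  induction l with
  | zero => simp
  | succ l ih =>
    rw [Finset.sum_Icc_succ_top (by lia)]
    have h1 : 1 ≤ l + 1 := by lia
    have hpos : 0 < β (l + 1 + 1) := hβ _ (by lia)
    have hα' : α (l + 1) = β (l + 1 + 1) * a (l + 1) := by
      have hne : 1 - a (l + 1) ≠ 0 := (sub_pos.2 (ha _ h1)).ne'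
      rw [hα _ h1, hβsucc _ h1]
      field_simp
    have hsq : α (l + 1) ^ 2 / β (l + 1 + 1) = β (l + 1 + 1) * a (l + 1) ^ 2 := by
      rw [hα']
      field_simp
    have hprev := ih fun i hi hil => hd i hi (by lia)
    have hmul := mul_le_mul_of_nonneg_left (hd (l + 1) h1 le_rfl) hpos.le
    rw [hβsucc _ h1] at hprev
    rw [hsq]
    linarith


theorem frank_wolfe_fw_gap_general_stepsizes
    {E : Type*} [NormedAddCommGroup E] [NormedSpace ℝ E] [FiniteDimensional ℝ E]
    (Q : Set E) (hQne : Q.Nonempty) (hQcomp : IsCompact Q) (hQconv : Convex ℝ Q)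
    (U : Set E) (hUopen : IsOpen U) (hQU : Q ⊆ U)
    (h : E → ℝ) (hconc : ConcaveOn ℝ Set.univ h) (hdiff : DifferentiableOn ℝ h U)
    (hstar : ℝ) (hhstar : IsGreatest (h '' Q) hstar)
    (C : ℝ) (hC : 0 ≤ C)
    (hcurv : ∀ lam ∈ Q, ∀ lam' ∈ Q, ∀ a ∈ Set.Icc (0:ℝ) 1,
      h (lam + a • (lam' - lam)) ≥
        h lam + a * (fderiv ℝ h lam) (lam' - lam) - C / 2 * a ^ 2)
    (ab : ℕ → ℝ) (lam lamt : ℕ → E) (Bw G B : ℕ → ℝ)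
    (hab : ∀ k, 1 ≤ k → ab k ∈ Set.Ico (0:ℝ) 1)
    (hlam1 : lam 1 ∈ Q)
    (hlamtQ : ∀ k, 1 ≤ k → lamt k ∈ Q)
    (hargmax : ∀ k, 1 ≤ k → ∀ l ∈ Q,
      (fderiv ℝ h (lam k)) (l - lam k) ≤ (fderiv ℝ h (lam k)) (lamt k - lam k))
    (hBw : ∀ k, 1 ≤ k → Bw k = h (lam k) + (fderiv ℝ h (lam k)) (lamt k - lam k))
    (hG : ∀ k, 1 ≤ k → G k = (fderiv ℝ h (lam k)) (lamt k - lam k))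
    (hnext : ∀ k, 1 ≤ k → lam (k+1) = lam k + ab k • (lamt k - lam k))
    (hBlb : ∀ k, hstar ≤ B k)
    (hBmono : ∀ k, 1 ≤ k → B k ≤ B (k-1))
    (hBBw : ∀ k, 1 ≤ k → B k ≤ Bw k)
    (alpha beta : ℕ → ℝ)
    (hbeta : ∀ k, 1 ≤ k → beta k = (∏ j ∈ Finset.Icc 1 (k-1), (1 - ab j))⁻¹)
    (halpha : ∀ k, 1 ≤ k → alpha k = beta k * ab k / (1 - ab k))
    :
    ∀ (l k : ℕ) (hlk : l + 1 ≤ k),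
      0 < ∑ i ∈ Finset.Icc (l+1) k, ab i →
      (Finset.Icc (l+1) k).inf' (Finset.nonempty_Icc.mpr hlk) G ≤
        (1 / ∑ i ∈ Finset.Icc (l+1) k, ab i) *
          ((B l - h (lam 1)) / beta (l+1)
            + (C / 2 * ∑ i ∈ Finset.Icc 1 l, alpha i ^ 2 / beta (i+1)) / beta (l+1))
        + (C / 2 * ∑ i ∈ Finset.Icc (l+1) k, ab i ^ 2) / (∑ i ∈ Finset.Icc (l+1) k, ab i) := by
  intro l k hlk hsum
  have hlamQ : ∀ k, 1 ≤ k → lam k ∈ Q := by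
    intro k hk
    induction k, hk using Nat.le_induction with
    | base => exact hlam1
    | succ k hk ih =>
      rw [hnext k hk]
      exact hQconv.add_smul_sub_mem ih (hlamtQ k hk) ⟨(hab k hk).1, (hab k hk).2.le⟩
  have hstep : ∀ i, 1 ≤ i →
      h (lam i) + ab i * G i - C / 2 * ab i ^ 2 ≤ h (lam (i + 1)) := by
    intro i hi
    rw [hnext i hi, hG i hi]
    exact hcurv _ (hlamQ i hi) _ (hlamtQ i hi) _ ⟨(hab i hi).1, (hab i hi).2.le⟩
  have hBanti : ∀ i, i ≤ l → B l ≤ B i := fun i hi =>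
    antitone_nat_of_succ_le (fun n => hBmono (n + 1) (by lia)) hi
  have hbeta1 : beta 1 = 1 := by simp [hbeta 1 le_rfl]
  have hbetapos : ∀ i, 1 ≤ i → 0 < beta i := by
    intro i hi
    rw [hbeta i hi]
    exact inv_pos.2 (Finset.prod_pos fun j hj =>
      sub_pos.2 (hab j (Finset.mem_Icc.1 hj).1).2)
  have hbetasucc : ∀ i, 1 ≤ i → beta i = beta (i + 1) * (1 - ab i) := by
    intro i hi
    have hne : 1 - ab i ≠ 0 := (sub_pos.2 (hab i hi).2).ne'
    obtain ⟨n, rfl⟩ : ∃ n, i = n + 1 := ⟨i - 1, by lia⟩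
    rw [hbeta _ hi, hbeta (n + 1 + 1) (by lia), Nat.add_sub_cancel, Nat.add_sub_cancel,
      Finset.prod_Icc_succ_top (by lia), mul_inv, inv_mul_cancel_right₀ hne]
  have hcontr : ∀ i, 1 ≤ i → i ≤ l →
      B l - h (lam (i + 1)) ≤ (1 - ab i) * (B l - h (lam i)) + C / 2 * ab i ^ 2 := by
    intro i hi hil
    have hgap : B l - h (lam i) ≤ G i := by
      linarith [hBanti i hil, hBBw i hi, hBw i hi, hG i hi]
    linarith [hstep i hi, mul_le_mul_of_nonneg_left hgap (hab i hi).1]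
  have hwarm := mul_le_add_sum_of_contraction (d := fun i => B l - h (lam i))
    (fun i hi => (hab i hi).2) hbetapos hbetasucc halpha hcontr
  have htele := sum_Icc_mul_le_of_step (f := fun i => h (lam i)) (l := l) (k := k) (by lia)
    fun i hi => hstep i (by lia)
  have htop : h (lam (k + 1)) ≤ B l :=
    (hhstar.2 ⟨_, hlamQ _ (by lia), rfl⟩).trans (hBlb l)
  have hmin : (∑ i ∈ Finset.Icc (l + 1) k, ab i) *
      (Finset.Icc (l + 1) k).inf' (Finset.nonempty_Icc.mpr hlk) G ≤
        ∑ i ∈ Finset.Icc (l + 1) k, ab i * G i := by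
    rw [Finset.sum_mul]
    refine Finset.sum_le_sum fun i hi => ?_
    exact mul_le_mul_of_nonneg_left (Finset.inf'_le _ hi)
      (hab i (by have := Finset.mem_Icc.1 hi; lia)).1
  have hstart : B l - h (lam (l + 1)) ≤ (B l - h (lam 1)) / beta (l + 1)
      + (C / 2 * ∑ i ∈ Finset.Icc 1 l, alpha i ^ 2 / beta (i + 1)) / beta (l + 1) := by
    rw [← add_div, le_div_iff₀' (hbetapos _ (by lia))]
    simpa [hbeta1] using hwarm
  rw [one_div_mul_eq_div, ← add_div, le_div_iff₀' hsum]
  linarith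
end

section
/- Suppose the Frank–Wolfe method is initialized with the pre-start step from λ_0 ∈ Q (so λ_1 := λ̃_0 and h* ≤ B_0 ≤ B^w_0) and run with step sizes ᾱ_i = 2/(i+2) for i ≥ 1. If C ≥ 0 is a curvature bound for (h,Q), then for all k ≥ 1: B_k − h(λ_{k+1}) ≤ 2C/(k+4). -/
/-- The recursion `k / (k + 2) * (2C / (k + 3)) + (C / 2) * (2 / (k + 2))²` stays below
`2C / (k + 4)`. -/
lemma standard_stepsize_recursion_le {C k : ℝ} (hC : 0 ≤ C) (hk : 0 ≤ k) :
    (1 - 2 / (k + 2)) * (2 * C / (k + 3)) + C / 2 * (2 / (k + 2)) ^ 2 ≤ 2 * C / (k + 4) := by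
  have key : 2 * C / (k + 4) -
      ((1 - 2 / (k + 2)) * (2 * C / (k + 3)) + C / 2 * (2 / (k + 2)) ^ 2) =
      2 * C * k / ((k + 4) * (k + 3) * (k + 2) ^ 2) := by
    field_simp
    ring
  have hnonneg : 0 ≤ 2 * C * k / ((k + 4) * (k + 3) * (k + 2) ^ 2) := by positivity
  linarith


theorem frank_wolfe_bound_gap_standard_stepsize
    {E : Type*} [NormedAddCommGroup E] [NormedSpace ℝ E] [FiniteDimensional ℝ E]
    (Q : Set E) (hQne : Q.Nonempty) (hQcomp : IsCompact Q) (hQconv : Convex ℝ Q)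
    (U : Set E) (hUopen : IsOpen U) (hQU : Q ⊆ U)
    (h : E → ℝ) (hconc : ConcaveOn ℝ Set.univ h) (hdiff : DifferentiableOn ℝ h U)
    (hstar : ℝ) (hhstar : IsGreatest (h '' Q) hstar)
    (C : ℝ) (hC : 0 ≤ C)
    (hcurv : ∀ lam ∈ Q, ∀ lam' ∈ Q, ∀ a ∈ Set.Icc (0:ℝ) 1,
      h (lam + a • (lam' - lam)) ≥
        h lam + a * (fderiv ℝ h lam) (lam' - lam) - C / 2 * a ^ 2)
    (ab : ℕ → ℝ) (lam lamt : ℕ → E) (Bw G B : ℕ → ℝ)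
    (hab : ∀ k, 1 ≤ k → ab k ∈ Set.Ico (0:ℝ) 1)
    (hlam0 : lam 0 ∈ Q)
    (hlamtQ : ∀ k, lamt k ∈ Q)
    (hargmax : ∀ k, ∀ l ∈ Q,
      (fderiv ℝ h (lam k)) (l - lam k) ≤ (fderiv ℝ h (lam k)) (lamt k - lam k))
    (hBw : ∀ k, Bw k = h (lam k) + (fderiv ℝ h (lam k)) (lamt k - lam k))
    (hG : ∀ k, G k = (fderiv ℝ h (lam k)) (lamt k - lam k))
    (hprestart : lam 1 = lamt 0)
    (hnext : ∀ k, 1 ≤ k → lam (k+1) = lam k + ab k • (lamt k - lam k))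
    (hBlb : ∀ k, hstar ≤ B k)
    (hBmono : ∀ k, 1 ≤ k → B k ≤ B (k-1))
    (hBBw : ∀ k, B k ≤ Bw k)
    (habval : ∀ i, 1 ≤ i → ab i = 2 / ((i : ℝ) + 2))
    :
    ∀ k, 1 ≤ k → B k - h (lam (k+1)) ≤ 2 * C / ((k : ℝ) + 4) := by
  have hlamQ : ∀ k, lam k ∈ Q := by
    intro k
    induction k with
    | zero => exact hlam0
    | succ n ih =>
      rcases Nat.eq_zero_or_pos n with rfl | hn
      · simpa [hprestart] using hlamtQ 0
      · rw [hnext n hn]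
        have ha := hab n hn
        exact hQconv.add_smul_sub_mem ih (hlamtQ n) ⟨ha.1, ha.2.le⟩
  have hgap : ∀ k, B k - h (lam (k + 1)) ≤ 2 * C / ((k : ℝ) + 4) := by
    intro k
    induction k with
    | zero =>
      have hc := hcurv (lam 0) (hlamQ 0) (lamt 0) (hlamtQ 0) 1 ⟨zero_le_one, le_rfl⟩
      rw [one_smul, add_sub_cancel, ← hprestart] at hc
      have hB := hBBw 0
      rw [hBw 0, ← hprestart] at hB
      simp only [zero_add, Nat.cast_zero]
      linarith
    | succ n ih =>
      have hn : 1 ≤ n + 1 := Nat.le_add_left 1 n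
      have ha := hab (n + 1) hn
      have hc := hcurv _ (hlamQ (n + 1)) _ (hlamtQ (n + 1)) (ab (n + 1)) ⟨ha.1, ha.2.le⟩
      rw [← hnext (n + 1) hn] at hc
      have hB := hBBw (n + 1)
      rw [hBw (n + 1)] at hB
      have hmono : B (n + 1) ≤ B n := hBmono (n + 1) hn
      have hwolfe := mul_le_mul_of_nonneg_left hB ha.1
      have hprev : (1 - ab (n + 1)) * (B (n + 1) - h (lam (n + 1))) ≤
          (1 - ab (n + 1)) * (2 * C / ((n : ℝ) + 4)) :=
        mul_le_mul_of_nonneg_left (by linarith) (sub_nonneg.mpr ha.2.le)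
      have hrec := standard_stepsize_recursion_le (k := ((n + 1 : ℕ) : ℝ)) hC (Nat.cast_nonneg _)
      rw [← habval (n + 1) hn,
        show ((n + 1 : ℕ) : ℝ) + 3 = (n : ℝ) + 4 by push_cast; ring] at hrec
      linarith
  exact fun k _ => hgap k
end

section
/- Suppose the Frank–Wolfe method is initialized with the pre-start step from λ_0 ∈ Q (so λ_1 := λ̃_0 and h* ≤ B_0 ≤ B^w_0) and run with step sizes ᾱ_i = 2/(i+2) for i ≥ 1. If C ≥ 0 is a curvature bound for (h,Q), then for all k ≥ 1: min_{i∈{1,…,k}} G_i ≤ 4.5·C/k. -/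
/-- The primal gap recursion of Frank–Wolfe with step sizes `2 / (i + 2)` and a good start decays
like `2 * C / (k + 3)`. -/
lemma primal_gap_le_of_recursion {C : ℝ} (hC : 0 ≤ C) {d : ℕ → ℝ} (h_one : d 1 ≤ C / 2)
    (hrec : ∀ i : ℕ, 1 ≤ i →
      d (i + 1) ≤ (1 - 2 / ((i : ℝ) + 2)) * d i + C / 2 * (2 / ((i : ℝ) + 2)) ^ 2)
    {k : ℕ} (hk : 1 ≤ k) : d k ≤ 2 * C / ((k : ℝ) + 3) := by
  induction k, hk using Nat.le_induction with
  | base => norm_num; linarith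
  | succ n hn ih =>
    have hn0 : (0 : ℝ) ≤ n := n.cast_nonneg
    have hfac : (0 : ℝ) ≤ 1 - 2 / ((n : ℝ) + 2) := by
      rw [sub_nonneg, div_le_one (by positivity)]
      linarith
    refine (hrec n hn).trans ?_
    have hmul := mul_le_mul_of_nonneg_left ih hfac
    have key : 2 * C / ((n : ℝ) + 1 + 3) - ((1 - 2 / ((n : ℝ) + 2)) * (2 * C / ((n : ℝ) + 3))
        + C / 2 * (2 / ((n : ℝ) + 2)) ^ 2)
        = 2 * C * n / (((n : ℝ) + 4) * ((n : ℝ) + 2) ^ 2 * ((n : ℝ) + 3)) := by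
      have h4 : (n : ℝ) + 1 + 3 = n + 4 := by ring
      rw [h4]
      field_simp
      ring
    have hpos : 0 ≤ 2 * C * n / (((n : ℝ) + 4) * ((n : ℝ) + 2) ^ 2 * ((n : ℝ) + 3)) := by
      positivity
    push_cast
    linarith

lemma harmonic_increment_le {x n : ℝ} (hx : 1 ≤ x) (hn : 0 ≤ n) :
    2 * (n + 1) / (2 * x + n) - 2 * n / (2 * x + n - 1) ≤ 1 / (x + n) := by
  have h₁ : 0 < 2 * x + n := by linarith
  have h₂ : 0 < 2 * x + n - 1 := by linarith
  have h₃ : 0 < x + n := by linarith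
  rw [div_sub_div _ _ h₁.ne' h₂.ne', div_le_div_iff₀ (by positivity) h₃]
  nlinarith [mul_nonneg hn hn]

lemma inv_sq_le_telescope {y : ℝ} (hy : 1 ≤ y) :
    1 / y ^ 2 ≤ 1 / (y - 1 / 2) - 1 / (y + 1 / 2) := by
  have h₁ : 0 < y - 1 / 2 := by linarith
  have h₂ : 0 < y + 1 / 2 := by linarith
  rw [div_sub_div _ _ h₁.ne' h₂.ne', div_le_div_iff₀ (by positivity) (by positivity)]
  nlinarith

/-- Accumulated decrease of the primal gap over `n` consecutive steps on which the Frank–Wolfe gap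
is at least `g`. -/
lemma primal_gap_le_of_gap_ge {C g : ℝ} (hC : 0 ≤ C) (hg : 0 ≤ g) {d : ℕ → ℝ} {l n : ℕ}
    (hrec : ∀ i : ℕ, l ≤ i → i < l + n →
      d (i + 1) ≤ d i - 2 / ((i : ℝ) + 2) * g + C / 2 * (2 / ((i : ℝ) + 2)) ^ 2) :
    d (l + n) ≤ d l - 2 * g * (2 * n / (2 * ((l : ℝ) + 2) + n - 1))
      + 2 * C * (1 / ((l : ℝ) + 2 - 1 / 2) - 1 / ((l : ℝ) + 2 + n - 1 / 2)) := by
  induction n with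
  | zero => simp
  | succ n ih =>
    have hl0 : (0 : ℝ) ≤ l := l.cast_nonneg
    have hn0 : (0 : ℝ) ≤ n := n.cast_nonneg
    have hprev := ih fun i h₁ h₂ => hrec i h₁ (by omega)
    have hstep := hrec (l + n) (by omega) (by omega)
    have hharm := mul_le_mul_of_nonneg_left
      (harmonic_increment_le (x := (l : ℝ) + 2) (n := n) (by linarith) hn0)
      (show 0 ≤ 2 * g by positivity)
    have hsq := mul_le_mul_of_nonneg_left
      (inv_sq_le_telescope (y := (l : ℝ) + 2 + n) (by linarith))
      (show 0 ≤ 2 * C by positivity)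
    have e₁ : 2 / (((l + n : ℕ) : ℝ) + 2) * g = 2 * g * (1 / ((l : ℝ) + 2 + n)) := by
      push_cast
      rw [add_right_comm]
      ring
    have e₂ : C / 2 * (2 / (((l + n : ℕ) : ℝ) + 2)) ^ 2 = 2 * C * (1 / ((l : ℝ) + 2 + n) ^ 2) := by
      push_cast
      rw [add_right_comm, div_pow]
      ring
    rw [e₁, e₂] at hstep
    have e₃ : 2 * ((l : ℝ) + 2) + ((n + 1 : ℕ) : ℝ) - 1 = 2 * ((l : ℝ) + 2) + n := by
      push_cast; ring
    have e₄ : (l : ℝ) + 2 + ((n + 1 : ℕ) : ℝ) - 1 / 2 = (l : ℝ) + 2 + n + 1 / 2 := by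
      push_cast; ring
    rw [e₃, e₄, ← add_assoc]
    push_cast
    linarith

lemma even_window_ratio_le {x : ℝ} (hx : 0 ≤ x) :
    (1 / (x + 3) + (1 / (x + 2 - 1 / 2) - 1 / (x + 2 + (x + 1) - 1 / 2))) * (2 * x)
      ≤ 4.5 * (2 * (x + 1) / (2 * (x + 2) + (x + 1) - 1)) := by
  have e₁ : x + 2 - 1 / 2 = (2 * x + 3) / 2 := by ring
  have e₂ : x + 2 + (x + 1) - 1 / 2 = (4 * x + 5) / 2 := by ring
  have e₃ : 2 * (x + 2) + (x + 1) - 1 = 3 * x + 4 := by ring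
  rw [e₁, e₂, e₃, ← sub_nonneg]
  field_simp
  ring_nf
  positivity

lemma odd_window_ratio_le {x : ℝ} (hx : 0 ≤ x) :
    (1 / (x + 4) + (1 / (x + 3 - 1 / 2) - 1 / (x + 3 + (x + 1) - 1 / 2))) * (2 * x + 1)
      ≤ 4.5 * (2 * (x + 1) / (2 * (x + 3) + (x + 1) - 1)) := by
  have e₁ : x + 3 - 1 / 2 = (2 * x + 5) / 2 := by ring
  have e₂ : x + 3 + (x + 1) - 1 / 2 = (4 * x + 7) / 2 := by ring
  have e₃ : 2 * (x + 3) + (x + 1) - 1 = 3 * x + 6 := by ring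
  rw [e₁, e₂, e₃, ← sub_nonneg]
  field_simp
  ring_nf
  positivity

lemma le_of_ratio_le {C g A b k : ℝ} (hC : 0 ≤ C) (hA : 0 < A) (hk : 0 < k)
    (hg : g * A ≤ C * b) (hb : b * k ≤ 4.5 * A) : g ≤ 4.5 * C / k := by
  rw [le_div_iff₀ hk]
  refine le_of_mul_le_mul_right ?_ hA
  have h₁ := mul_le_mul_of_nonneg_right hg hk.le
  have h₂ := mul_le_mul_of_nonneg_left hb hC
  linarith

/-- If the gap stays at least `g` along the first `k` steps, then `g ≤ 4.5 * C / k`. -/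
lemma gap_lower_bound_le {C g : ℝ} (hC : 0 ≤ C) (hg : 0 ≤ g) {d : ℕ → ℝ} {k : ℕ} (hk : 1 ≤ k)
    (hd0 : 0 ≤ d (k + 1))
    (hd : ∀ i : ℕ, 1 ≤ i → d i ≤ 2 * C / ((i : ℝ) + 3))
    (hrec : ∀ i : ℕ, 1 ≤ i → i ≤ k →
      d (i + 1) ≤ d i - 2 / ((i : ℝ) + 2) * g + C / 2 * (2 / ((i : ℝ) + 2)) ^ 2) :
    g ≤ 4.5 * C / k := by
  obtain ⟨m, rfl | rfl⟩ := Nat.even_or_odd' k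
  · have hsum := primal_gap_le_of_gap_ge (l := m) (n := m + 1) hC hg
      fun i h₁ h₂ => hrec i (by omega) (by omega)
    rw [show m + (m + 1) = 2 * m + 1 by ring] at hsum
    have hstart := hd m (by omega)
    have hm : (1 : ℝ) ≤ m := by exact_mod_cast (show 1 ≤ m by omega)
    push_cast at hsum ⊢
    refine le_of_ratio_le hC ?_ (by linarith) ?_ (even_window_ratio_le (by linarith))
    · exact div_pos (by linarith) (by linarith)
    · rw [← mul_one_div] at hstart
      linarith
  · have hsum := primal_gap_le_of_gap_ge (l := m + 1) (n := m + 1) hC hg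
      fun i h₁ h₂ => hrec i (by omega) (by omega)
    rw [show m + 1 + (m + 1) = 2 * m + 1 + 1 by ring] at hsum
    have hstart := hd (m + 1) (by omega)
    have hm : (0 : ℝ) ≤ m := m.cast_nonneg
    push_cast at hsum hstart ⊢
    rw [show (m : ℝ) + 1 + 2 = m + 3 by ring] at hsum
    rw [show (m : ℝ) + 1 + 3 = m + 4 by ring, ← mul_one_div] at hstart
    refine le_of_ratio_le hC ?_ (by linarith) ?_ (odd_window_ratio_le hm)
    · exact div_pos (by linarith) (by linarith)
    · linarith


theorem frank_wolfe_fw_gap_standard_stepsize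
    {E : Type*} [NormedAddCommGroup E] [NormedSpace ℝ E] [FiniteDimensional ℝ E]
    (Q : Set E) (hQne : Q.Nonempty) (hQcomp : IsCompact Q) (hQconv : Convex ℝ Q)
    (U : Set E) (hUopen : IsOpen U) (hQU : Q ⊆ U)
    (h : E → ℝ) (hconc : ConcaveOn ℝ Set.univ h) (hdiff : DifferentiableOn ℝ h U)
    (hstar : ℝ) (hhstar : IsGreatest (h '' Q) hstar)
    (C : ℝ) (hC : 0 ≤ C)
    (hcurv : ∀ lam ∈ Q, ∀ lam' ∈ Q, ∀ a ∈ Set.Icc (0:ℝ) 1,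
      h (lam + a • (lam' - lam)) ≥
        h lam + a * (fderiv ℝ h lam) (lam' - lam) - C / 2 * a ^ 2)
    (ab : ℕ → ℝ) (lam lamt : ℕ → E) (Bw G B : ℕ → ℝ)
    (hab : ∀ k, 1 ≤ k → ab k ∈ Set.Ico (0:ℝ) 1)
    (hlam0 : lam 0 ∈ Q)
    (hlamtQ : ∀ k, lamt k ∈ Q)
    (hargmax : ∀ k, ∀ l ∈ Q,
      (fderiv ℝ h (lam k)) (l - lam k) ≤ (fderiv ℝ h (lam k)) (lamt k - lam k))
    (hBw : ∀ k, Bw k = h (lam k) + (fderiv ℝ h (lam k)) (lamt k - lam k))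
    (hG : ∀ k, G k = (fderiv ℝ h (lam k)) (lamt k - lam k))
    (hprestart : lam 1 = lamt 0)
    (hnext : ∀ k, 1 ≤ k → lam (k+1) = lam k + ab k • (lamt k - lam k))
    (hBlb : ∀ k, hstar ≤ B k)
    (hBmono : ∀ k, 1 ≤ k → B k ≤ B (k-1))
    (hBBw : ∀ k, B k ≤ Bw k)
    (habval : ∀ i, 1 ≤ i → ab i = 2 / ((i : ℝ) + 2))
    :
    ∀ (k : ℕ) (hk : 1 ≤ k),
      (Finset.Icc 1 k).inf' (Finset.nonempty_Icc.mpr hk) G ≤ 4.5 * C / (k : ℝ) := by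
  intro k hk
  have hmem : ∀ i, 1 ≤ i → lam i ∈ Q := by
    intro i hi
    induction i, hi using Nat.le_induction with
    | base => exact hprestart ▸ hlamtQ 0
    | succ n hn ih =>
      rw [hnext n hn]
      exact hQconv.add_smul_sub_mem ih (hlamtQ n) ⟨(hab n hn).1, (hab n hn).2.le⟩
  have hprimal_le : ∀ i, hstar - h (lam i) ≤ G i := fun i => by
    linarith [hBlb i, hBBw i, hBw i, hG i]
  have hprimal_nonneg : ∀ i, 1 ≤ i → 0 ≤ hstar - h (lam i) := fun i hi =>
    sub_nonneg.mpr (hhstar.2 ⟨lam i, hmem i hi, rfl⟩)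
  have hstep : ∀ i : ℕ, 1 ≤ i → hstar - h (lam (i + 1)) ≤
      hstar - h (lam i) - 2 / ((i : ℝ) + 2) * G i + C / 2 * (2 / ((i : ℝ) + 2)) ^ 2 := by
    intro i hi
    have hc := hcurv _ (hmem i hi) _ (hlamtQ i) (ab i) ⟨(hab i hi).1, (hab i hi).2.le⟩
    rw [← hnext i hi, ← hG i, habval i hi] at hc
    linarith
  have h_one : hstar - h (lam 1) ≤ C / 2 := by
    have hc := hcurv _ hlam0 _ (hlamtQ 0) 1 ⟨zero_le_one, le_rfl⟩
    rw [one_smul, add_sub_cancel, ← hprestart, hprestart, ← hG 0, ← hprestart] at hc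
    linarith [hprimal_le 0]
  have hdecay : ∀ i : ℕ, 1 ≤ i → hstar - h (lam i) ≤ 2 * C / ((i : ℝ) + 3) := fun i hi =>
    primal_gap_le_of_recursion (d := fun i => hstar - h (lam i)) hC h_one
      (fun j hj => by
        have := mul_le_mul_of_nonneg_left (hprimal_le j)
          (show (0 : ℝ) ≤ 2 / ((j : ℝ) + 2) by positivity)
        linarith [hstep j hj]) hi
  refine gap_lower_bound_le (d := fun i => hstar - h (lam i)) hC ?_ hk
    (hprimal_nonneg _ (by omega)) hdecay fun i h₁ h₂ => ?_
  · refine Finset.le_inf' _ _ fun i hi => ?_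
    exact (hprimal_nonneg i (Finset.mem_Icc.mp hi).1).trans (hprimal_le i)
  · have hinf := mul_le_mul_of_nonneg_left
      (Finset.inf'_le G (Finset.mem_Icc.mpr ⟨h₁, h₂⟩))
      (show (0 : ℝ) ≤ 2 / ((i : ℝ) + 2) by positivity)
    linarith [hstep i h₁]
end

section
/- Suppose the Frank–Wolfe method is initialized with the pre-start step from λ_0 ∈ Q (so λ_1 := λ̃_0 and h* ≤ B_0 ≤ B^w_0) and run with the simple-averaging step sizes ᾱ_i = 1/(i+1) for i ≥ 1. If C ≥ 0 is a curvature bound for (h,Q), then for all k ≥ 0: B_k − h(λ_{k+1}) ≤ (C/2)·(1 + ln(k+1))/(k+1). -/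
/-- The increment of the logarithm dominates the harmonic increment. -/
theorem one_div_add_one_le_log_sub_log {x : ℝ} (hx : 0 < x) :
    1 / (x + 1) ≤ Real.log (x + 1) - Real.log x := by
  have hx1 : 0 < x + 1 := by linarith
  rw [← Real.log_div hx1.ne' hx.ne']
  refine le_trans (le_of_eq ?_) (Real.one_sub_inv_le_log_of_pos (div_pos hx1 hx))
  field_simp
  ring

theorem frank_wolfe_bound_gap_simple_averaging
    {E : Type*} [NormedAddCommGroup E] [NormedSpace ℝ E] [FiniteDimensional ℝ E]
    (Q : Set E) (hQne : Q.Nonempty) (hQcomp : IsCompact Q) (hQconv : Convex ℝ Q)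
    (U : Set E) (hUopen : IsOpen U) (hQU : Q ⊆ U)
    (h : E → ℝ) (hconc : ConcaveOn ℝ Set.univ h) (hdiff : DifferentiableOn ℝ h U)
    (hstar : ℝ) (hhstar : IsGreatest (h '' Q) hstar)
    (C : ℝ) (hC : 0 ≤ C)
    (hcurv : ∀ lam ∈ Q, ∀ lam' ∈ Q, ∀ a ∈ Set.Icc (0:ℝ) 1,
      h (lam + a • (lam' - lam)) ≥
        h lam + a * (fderiv ℝ h lam) (lam' - lam) - C / 2 * a ^ 2)
    (ab : ℕ → ℝ) (lam lamt : ℕ → E) (Bw G B : ℕ → ℝ)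
    (hab : ∀ k, 1 ≤ k → ab k ∈ Set.Ico (0:ℝ) 1)
    (hlam0 : lam 0 ∈ Q)
    (hlamtQ : ∀ k, lamt k ∈ Q)
    (hargmax : ∀ k, ∀ l ∈ Q,
      (fderiv ℝ h (lam k)) (l - lam k) ≤ (fderiv ℝ h (lam k)) (lamt k - lam k))
    (hBw : ∀ k, Bw k = h (lam k) + (fderiv ℝ h (lam k)) (lamt k - lam k))
    (hG : ∀ k, G k = (fderiv ℝ h (lam k)) (lamt k - lam k))
    (hprestart : lam 1 = lamt 0)
    (hnext : ∀ k, 1 ≤ k → lam (k+1) = lam k + ab k • (lamt k - lam k))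
    (hBlb : ∀ k, hstar ≤ B k)
    (hBmono : ∀ k, 1 ≤ k → B k ≤ B (k-1))
    (hBBw : ∀ k, B k ≤ Bw k)
    (habval : ∀ i, 1 ≤ i → ab i = 1 / ((i : ℝ) + 1))
    :
    ∀ k : ℕ, B k - h (lam (k+1)) ≤
      C / 2 * (1 + Real.log ((k : ℝ) + 1)) / ((k : ℝ) + 1) := by
  have hmem : ∀ k, lam k ∈ Q := by
    intro k
    induction k with
    | zero => exact hlam0
    | succ k ih =>
      rcases Nat.eq_zero_or_pos k with rfl | hk
      · rw [zero_add, hprestart]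
        exact hlamtQ 0
      · rw [hnext k hk]
        exact hQconv.add_smul_sub_mem ih (hlamtQ k)
          ⟨(hab k hk).1, (hab k hk).2.le⟩
  intro k
  rw [le_div_iff₀ (by positivity)]
  induction k with
  | zero =>
    have hc := hcurv _ (hmem 0) _ (hlamtQ 0) 1 ⟨zero_le_one, le_rfl⟩
    rw [one_smul, add_sub_cancel, ← hprestart] at hc
    have hB := hBBw 0
    rw [hBw, ← hprestart] at hB
    norm_num
    linarith
  | succ n ih =>
    have hn : 1 ≤ n + 1 := Nat.le_add_left 1 n
    have hIco := hab (n + 1) hn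
    have hc := hcurv _ (hmem (n + 1)) _ (hlamtQ (n + 1)) (ab (n + 1))
      ⟨hIco.1, hIco.2.le⟩
    rw [← hnext (n + 1) hn, habval (n + 1) hn] at hc
    have hB := hBBw (n + 1)
    rw [hBw] at hB
    have hmono := hBmono (n + 1) hn
    rw [Nat.add_sub_cancel] at hmono
    push_cast at hc ⊢
    obtain ⟨x, hxn⟩ : ∃ x : ℝ, x = (n : ℝ) + 1 := ⟨_, rfl⟩
    rw [← hxn] at hc ih ⊢
    have hx : 0 < x := by rw [hxn]; positivity
    have hx1 : 0 < x + 1 := by linarith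
    have hlog := mul_le_mul_of_nonneg_left (one_div_add_one_le_log_sub_log hx)
      (div_nonneg hC zero_le_two)
    have hscaled := mul_le_mul_of_nonneg_right hc hx1.le
    have hcancel : (h (lam (n + 1)) + 1 / (x + 1) *
        (fderiv ℝ h (lam (n + 1))) (lamt (n + 1) - lam (n + 1)) -
          C / 2 * (1 / (x + 1)) ^ 2) * (x + 1) =
        h (lam (n + 1)) * (x + 1) +
          (fderiv ℝ h (lam (n + 1))) (lamt (n + 1) - lam (n + 1)) -
          C / 2 * (1 / (x + 1)) := by
      field_simp
    rw [hcancel] at hscaled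
    have hmono' := mul_le_mul_of_nonneg_right hmono hx.le
    linarith
end

section
/- Let {λ_k}, {λ̃_k}, {B^w_k}, {G_k}, {B_k} be a Frank–Wolfe iterate sequence with the constant step sizes ᾱ_i = ᾱ for all i ≥ 1, where ᾱ ∈ (0,1), and let C ≥ 0 be a curvature bound for (h,Q). Then for all k ≥ 1: B_k − h(λ_{k+1}) ≤ (B_k − h(λ_1))·(1−ᾱ)^k + (C/2)·[ ᾱ − ᾱ·(1−ᾱ)^k ]. -/
/-- A geometric bound for a sequence of gaps that contracts by `1 - a` at each step, up to an
additive error `c * a ^ 2`. -/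
theorem le_geometric_of_contracting_add_sq {e : ℕ → ℝ} {a c : ℝ} (ha : a ≤ 1) (k : ℕ)
    (he : ∀ j, 1 ≤ j → j ≤ k → e (j + 1) ≤ (1 - a) * e j + c * a ^ 2) :
    e (k + 1) ≤ e 1 * (1 - a) ^ k + c * (a - a * (1 - a) ^ k) := by
  induction k with
  | zero => simp
  | succ n ih =>
    have hn := ih fun j h1 hj => he j h1 (hj.trans n.le_succ)
    calc e (n + 1 + 1) ≤ (1 - a) * e (n + 1) + c * a ^ 2 := he (n + 1) (by omega) le_rfl
      _ ≤ (1 - a) * (e 1 * (1 - a) ^ n + c * (a - a * (1 - a) ^ n)) + c * a ^ 2 := by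
        have := mul_le_mul_of_nonneg_left hn (sub_nonneg.2 ha)
        linarith
      _ = e 1 * (1 - a) ^ (n + 1) + c * (a - a * (1 - a) ^ (n + 1)) := by ring


theorem frank_wolfe_bound_gap_constant_stepsize
    {E : Type*} [NormedAddCommGroup E] [NormedSpace ℝ E] [FiniteDimensional ℝ E]
    (Q : Set E) (hQne : Q.Nonempty) (hQcomp : IsCompact Q) (hQconv : Convex ℝ Q)
    (U : Set E) (hUopen : IsOpen U) (hQU : Q ⊆ U)
    (h : E → ℝ) (hconc : ConcaveOn ℝ Set.univ h) (hdiff : DifferentiableOn ℝ h U)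
    (hstar : ℝ) (hhstar : IsGreatest (h '' Q) hstar)
    (C : ℝ) (hC : 0 ≤ C)
    (hcurv : ∀ lam ∈ Q, ∀ lam' ∈ Q, ∀ a ∈ Set.Icc (0:ℝ) 1,
      h (lam + a • (lam' - lam)) ≥
        h lam + a * (fderiv ℝ h lam) (lam' - lam) - C / 2 * a ^ 2)
    (ab : ℕ → ℝ) (lam lamt : ℕ → E) (Bw G B : ℕ → ℝ)
    (hab : ∀ k, 1 ≤ k → ab k ∈ Set.Ico (0:ℝ) 1)
    (hlam1 : lam 1 ∈ Q)
    (hlamtQ : ∀ k, 1 ≤ k → lamt k ∈ Q)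
    (hargmax : ∀ k, 1 ≤ k → ∀ l ∈ Q,
      (fderiv ℝ h (lam k)) (l - lam k) ≤ (fderiv ℝ h (lam k)) (lamt k - lam k))
    (hBw : ∀ k, 1 ≤ k → Bw k = h (lam k) + (fderiv ℝ h (lam k)) (lamt k - lam k))
    (hG : ∀ k, 1 ≤ k → G k = (fderiv ℝ h (lam k)) (lamt k - lam k))
    (hnext : ∀ k, 1 ≤ k → lam (k+1) = lam k + ab k • (lamt k - lam k))
    (hBlb : ∀ k, hstar ≤ B k)
    (hBmono : ∀ k, 1 ≤ k → B k ≤ B (k-1))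
    (hBBw : ∀ k, 1 ≤ k → B k ≤ Bw k)
    (a : ℝ) (ha : a ∈ Set.Ioo (0:ℝ) 1)
    (habval : ∀ i, 1 ≤ i → ab i = a)
    :
    ∀ k, 1 ≤ k → B k - h (lam (k+1)) ≤
      (B k - h (lam 1)) * (1 - a) ^ k + C / 2 * (a - a * (1 - a) ^ k) := by
  have hmem : ∀ j, 1 ≤ j → lam j ∈ Q := by
    intro j hj
    induction j, hj using Nat.le_induction with
    | base => exact hlam1
    | succ n hn ih =>
      rw [hnext n hn]
      exact hQconv.add_smul_sub_mem ih (hlamtQ n hn) (Set.Ico_subset_Icc_self (hab n hn))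
  intro k _
  have hBanti : ∀ j, j ≤ k → B k ≤ B j := fun j hj =>
    antitone_nat_of_succ_le (fun n => hBmono (n + 1) n.succ_pos) hj
  refine le_geometric_of_contracting_add_sq (e := fun j => B k - h (lam j)) ha.2.le k
    fun j hj hjk => ?_
  have hstep := hcurv (lam j) (hmem j hj) (lamt j) (hlamtQ j hj) a (Set.Ioo_subset_Icc_self ha)
  have hgap : B k ≤ h (lam j) + fderiv ℝ h (lam j) (lamt j - lam j) :=
    (hBanti j hjk).trans ((hBBw j hj).trans_eq (hBw j hj))
  have := mul_le_mul_of_nonneg_left hgap ha.1.le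
  rw [← habval j hj, ← hnext j hj, habval j hj] at hstep
  linarith
end

section
/- Suppose the Frank–Wolfe method is initialized with the pre-start step from λ_0 ∈ Q (so λ_1 := λ̃_0 and h* ≤ B_0 ≤ B^w_0) and run with the constant step sizes ᾱ_i = ᾱ for all i ≥ 1, where ᾱ ∈ (0,1). If C ≥ 0 is a curvature bound for (h,Q), then for all k ≥ 1: B_k − h(λ_{k+1}) ≤ (C/2)·[ (1−ᾱ)^{k+1} + ᾱ ]. -/
theorem frank_wolfe_bound_gap_constant_stepsize_prestart
    {E : Type*} [NormedAddCommGroup E] [NormedSpace ℝ E] [FiniteDimensional ℝ E]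
    (Q : Set E) (hQne : Q.Nonempty) (hQcomp : IsCompact Q) (hQconv : Convex ℝ Q)
    (U : Set E) (hUopen : IsOpen U) (hQU : Q ⊆ U)
    (h : E → ℝ) (hconc : ConcaveOn ℝ Set.univ h) (hdiff : DifferentiableOn ℝ h U)
    (hstar : ℝ) (hhstar : IsGreatest (h '' Q) hstar)
    (C : ℝ) (hC : 0 ≤ C)
    (hcurv : ∀ lam ∈ Q, ∀ lam' ∈ Q, ∀ a ∈ Set.Icc (0:ℝ) 1,
      h (lam + a • (lam' - lam)) ≥
        h lam + a * (fderiv ℝ h lam) (lam' - lam) - C / 2 * a ^ 2)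
    (ab : ℕ → ℝ) (lam lamt : ℕ → E) (Bw G B : ℕ → ℝ)
    (hab : ∀ k, 1 ≤ k → ab k ∈ Set.Ico (0:ℝ) 1)
    (hlam0 : lam 0 ∈ Q)
    (hlamtQ : ∀ k, lamt k ∈ Q)
    (hargmax : ∀ k, ∀ l ∈ Q,
      (fderiv ℝ h (lam k)) (l - lam k) ≤ (fderiv ℝ h (lam k)) (lamt k - lam k))
    (hBw : ∀ k, Bw k = h (lam k) + (fderiv ℝ h (lam k)) (lamt k - lam k))
    (hG : ∀ k, G k = (fderiv ℝ h (lam k)) (lamt k - lam k))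
    (hprestart : lam 1 = lamt 0)
    (hnext : ∀ k, 1 ≤ k → lam (k+1) = lam k + ab k • (lamt k - lam k))
    (hBlb : ∀ k, hstar ≤ B k)
    (hBmono : ∀ k, 1 ≤ k → B k ≤ B (k-1))
    (hBBw : ∀ k, B k ≤ Bw k)
    (a : ℝ) (ha : a ∈ Set.Ioo (0:ℝ) 1)
    (habval : ∀ i, 1 ≤ i → ab i = a)
    :
    ∀ k, 1 ≤ k → B k - h (lam (k+1)) ≤
      C / 2 * ((1 - a) ^ (k + 1) + a) := by
  obtain ⟨ha0, ha1⟩ := ha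
  have hlamQ : ∀ k, lam (k + 1) ∈ Q := by
    intro k
    induction k with
    | zero => simpa [hprestart] using hlamtQ 0
    | succ k ih =>
      rw [hnext (k + 1) (by omega), habval (k + 1) (by omega)]
      exact hQconv.add_smul_sub_mem ih (hlamtQ _) ⟨ha0.le, ha1.le⟩
  have key : ∀ k, B k - h (lam (k + 1)) ≤ C / 2 * ((1 - a) ^ (k + 1) + a) := by
    intro k
    induction k with
    | zero =>
      have hstep := hcurv (lam 0) hlam0 (lamt 0) (hlamtQ 0) 1 ⟨zero_le_one, le_rfl⟩
      rw [one_smul, add_sub_cancel] at hstep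
      have hB0 := hBBw 0
      rw [hBw] at hB0
      rw [zero_add, hprestart]
      linarith
    | succ k ih =>
      have hstep := hcurv (lam (k + 1)) (hlamQ k) (lamt (k + 1)) (hlamtQ _) a ⟨ha0.le, ha1.le⟩
      rw [hnext (k + 1) (by omega), habval (k + 1) (by omega)]
      have hB := hBBw (k + 1)
      rw [hBw] at hB
      have hmono : B (k + 1) ≤ B k := hBmono (k + 1) (by omega)
      have hgap := mul_le_mul_of_nonneg_left hB ha0.le
      have hprev : (1 - a) * (B (k + 1) - h (lam (k + 1))) ≤
          (1 - a) * (C / 2 * ((1 - a) ^ (k + 1) + a)) :=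
        mul_le_mul_of_nonneg_left (by linarith) (by linarith)
      rw [pow_succ (1 - a) (k + 1)]
      linarith
  exact fun k _ => key k
end

section
/- Fix k ≥ 1 and set ᾱ* := 1 − 1/(k+1)^{1/k}. Suppose the Frank–Wolfe method is initialized with the pre-start step from λ_0 ∈ Q (so λ_1 := λ̃_0 and h* ≤ B_0 ≤ B^w_0) and run with the constant step sizes ᾱ_i = ᾱ* for all i ≥ 1. If C ≥ 0 is a curvature bound for (h,Q), then after k iterations: B_k − h(λ_{k+1}) ≤ (C/2)·(1 + ln(k+1))/k. -/
theorem frank_wolfe_bound_gap_optimized_constant_stepsize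
    {E : Type*} [NormedAddCommGroup E] [NormedSpace ℝ E] [FiniteDimensional ℝ E]
    (Q : Set E) (hQne : Q.Nonempty) (hQcomp : IsCompact Q) (hQconv : Convex ℝ Q)
    (U : Set E) (hUopen : IsOpen U) (hQU : Q ⊆ U)
    (h : E → ℝ) (hconc : ConcaveOn ℝ Set.univ h) (hdiff : DifferentiableOn ℝ h U)
    (hstar : ℝ) (hhstar : IsGreatest (h '' Q) hstar)
    (C : ℝ) (hC : 0 ≤ C)
    (hcurv : ∀ lam ∈ Q, ∀ lam' ∈ Q, ∀ a ∈ Set.Icc (0:ℝ) 1,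
      h (lam + a • (lam' - lam)) ≥
        h lam + a * (fderiv ℝ h lam) (lam' - lam) - C / 2 * a ^ 2)
    (ab : ℕ → ℝ) (lam lamt : ℕ → E) (Bw G B : ℕ → ℝ)
    (hab : ∀ k, 1 ≤ k → ab k ∈ Set.Ico (0:ℝ) 1)
    (hlam0 : lam 0 ∈ Q)
    (hlamtQ : ∀ k, lamt k ∈ Q)
    (hargmax : ∀ k, ∀ l ∈ Q,
      (fderiv ℝ h (lam k)) (l - lam k) ≤ (fderiv ℝ h (lam k)) (lamt k - lam k))
    (hBw : ∀ k, Bw k = h (lam k) + (fderiv ℝ h (lam k)) (lamt k - lam k))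
    (hG : ∀ k, G k = (fderiv ℝ h (lam k)) (lamt k - lam k))
    (hprestart : lam 1 = lamt 0)
    (hnext : ∀ k, 1 ≤ k → lam (k+1) = lam k + ab k • (lamt k - lam k))
    (hBlb : ∀ k, hstar ≤ B k)
    (hBmono : ∀ k, 1 ≤ k → B k ≤ B (k-1))
    (hBBw : ∀ k, B k ≤ Bw k)
    (k : ℕ) (hk : 1 ≤ k)
    (a : ℝ) (ha : a = 1 - 1 / (((k : ℝ) + 1) ^ ((1 : ℝ) / (k : ℝ))))
    (habval : ∀ i, 1 ≤ i → ab i = a)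
    :
    B k - h (lam (k+1)) ≤ C / 2 * (1 + Real.log ((k : ℝ) + 1)) / (k : ℝ) := by
  have hlamQ : ∀ n, lam n ∈ Q ∧ lam (n + 1) ∈ Q := by
    intro n
    induction n with
    | zero => exact ⟨hlam0, by simpa [hprestart] using hlamtQ 0⟩
    | succ n ih =>
      refine ⟨ih.2, ?_⟩
      rw [hnext (n + 1) (by omega)]
      have hstep := hab (n + 1) (by omega)
      exact hQconv.add_smul_sub_mem ih.2 (hlamtQ _) ⟨hstep.1, hstep.2.le⟩
  have ha01 : a ∈ Set.Ico (0 : ℝ) 1 := habval 1 le_rfl ▸ hab 1 le_rfl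
  have hgap : ∀ n, B n - h (lam (n + 1)) ≤ C / 2 * ((1 - a) ^ n + a * (1 - (1 - a) ^ n)) := by
    intro n
    induction n with
    | zero =>
      have hc := hcurv _ (hlamQ 0).1 _ (hlamtQ 0) 1 (by simp)
      rw [one_smul, add_sub_cancel] at hc
      have hB := hBBw 0
      rw [hBw] at hB
      rw [zero_add, hprestart]
      simp only [pow_zero]
      linarith
    | succ n ih =>
      have hc := hcurv _ (hlamQ n).2 _ (hlamtQ (n + 1)) a ⟨ha01.1, ha01.2.le⟩
      have hB := hBBw (n + 1)
      rw [hBw] at hB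
      have hm : B (n + 1) ≤ B n := by simpa using hBmono (n + 1) (by omega)
      rw [hnext (n + 1) (by omega), habval (n + 1) (by omega), pow_succ]
      have h1 := mul_le_mul_of_nonneg_left hB ha01.1
      have h2 := mul_le_mul_of_nonneg_left (hm.trans (sub_le_iff_le_add.mp ih))
        (sub_nonneg.mpr ha01.2.le)
      linarith
  have hk0 : (0 : ℝ) < k := by exact_mod_cast hk
  have hpow : (1 - a) ^ k = 1 / ((k : ℝ) + 1) := by
    rw [ha, sub_sub_cancel, div_pow, one_pow, one_div (k : ℝ),
      Real.rpow_inv_natCast_pow (by positivity) (by omega)]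
  have hale : a * k ≤ Real.log ((k : ℝ) + 1) := by
    have hlog := Real.log_le_sub_one_of_pos (sub_pos.mpr ha01.2)
    have hlogpow := congrArg Real.log hpow
    rw [Real.log_pow, one_div, Real.log_inv] at hlogpow
    nlinarith
  have hlog0 : 0 ≤ Real.log ((k : ℝ) + 1) := Real.log_nonneg (by linarith)
  calc B k - h (lam (k + 1))
      ≤ C / 2 * ((1 - a) ^ k + a * (1 - (1 - a) ^ k)) := hgap k
    _ = C / 2 * (1 + a * k) / (k + 1) := by
      rw [hpow]
      field_simp
      ring
    _ ≤ C / 2 * (1 + Real.log ((k : ℝ) + 1)) / k := by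
      gcongr
      linarith
end

section
/- Fix k ≥ 1 and set ᾱ* := 1 − 1/(k+1)^{1/k}. Suppose the Frank–Wolfe method is initialized with the pre-start step from λ_0 ∈ Q (so λ_1 := λ̃_0 and h* ≤ B_0 ≤ B^w_0) and run with the constant step sizes ᾱ_i = ᾱ* for all i ≥ 1. If C ≥ 0 is a curvature bound for (h,Q), then after 2k+1 iterations: min_{i∈{1,…,2k+1}} G_i ≤ (C/2)·(1 + 2·ln(k+1))/k. -/
/-- The scalar estimate behind the step size `a = 1 - (k + 1) ^ (-1 / k)`. -/
lemma fw_constant_step_estimate (k : ℕ) (hk : 1 ≤ k) (a : ℝ)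
    (ha : a = 1 - 1 / (((k : ℝ) + 1) ^ ((1 : ℝ) / (k : ℝ)))) :
    0 < a ∧ (1 - a) ^ k = 1 / ((k : ℝ) + 1) ∧
      1 / (((k : ℝ) + 1) ^ 2 * a) + k / ((k : ℝ) + 1) ^ 2 + a ≤
        (1 + 2 * Real.log ((k : ℝ) + 1)) / k := by
  have hk' : (1 : ℝ) ≤ k := by exact_mod_cast hk
  have hk0 : (0 : ℝ) < k := by linarith
  have hk1 : (0 : ℝ) < (k : ℝ) + 1 := by linarith
  have hpow : (1 - a) ^ k = 1 / ((k : ℝ) + 1) := by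
    rw [ha, sub_sub_cancel, div_pow, one_pow, ← Real.rpow_natCast, ← Real.rpow_mul hk1.le,
      one_div_mul_cancel hk0.ne', Real.rpow_one]
  set L := Real.log ((k : ℝ) + 1) with hL
  have hLpos : 0 < L := Real.log_pos (by linarith)
  have hexp : a = 1 - 1 / Real.exp (L / k) := by
    rw [ha, Real.rpow_def_of_pos hk1, ← hL, mul_one_div]
  have hx : 0 < L / k := div_pos hLpos hk0
  have hupper : a ≤ L / k := by
    have := Real.add_one_le_exp (-(L / k))
    rw [hexp, one_div, ← Real.exp_neg]
    linarith
  have hlower : (L / k) / (1 + L / k) ≤ a := by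
    have h1 := Real.add_one_le_exp (L / k)
    have h2 : 1 / Real.exp (L / k) ≤ 1 / (L / k + 1) :=
      one_div_le_one_div_of_le (by linarith) h1
    have h3 : (L / k) / (1 + L / k) = 1 - 1 / (L / k + 1) := by
      field_simp
      ring
    rw [hexp, h3]
    linarith
  have hapos : 0 < a := lt_of_lt_of_le (by positivity) hlower
  refine ⟨hapos, hpow, ?_⟩
  have hinv : 1 / a ≤ 1 + k / L := by
    have h1 := one_div_le_one_div_of_le (by positivity) hlower
    have h2 : 1 / ((L / k) / (1 + L / k)) = 1 + k / L := by
      field_simp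
      ring
    linarith
  set u : ℝ := k / ((k : ℝ) + 1) with hu
  have hu0 : 0 < u := by positivity
  have huL : u ≤ L := by
    have h1 := Real.one_sub_inv_le_log_of_pos hk1
    have h2 : u = 1 - ((k : ℝ) + 1)⁻¹ := by
      rw [hu]
      field_simp
      ring
    linarith
  have hu1 : u ≤ 1 := by
    rw [hu, div_le_one hk1]
    linarith
  have huu : u ^ 2 / L ≤ u := by
    rw [div_le_iff₀ hLpos]
    nlinarith
  calc 1 / (((k : ℝ) + 1) ^ 2 * a) + k / ((k : ℝ) + 1) ^ 2 + a
      = 1 / ((k : ℝ) + 1) ^ 2 * (1 / a) + k / ((k : ℝ) + 1) ^ 2 + a := by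
        rw [one_div_mul_one_div]
    _ ≤ 1 / ((k : ℝ) + 1) ^ 2 * (1 + k / L) + k / ((k : ℝ) + 1) ^ 2 + L / k := by gcongr
    _ = (u + u ^ 2 / L + L) / k := by
        rw [hu]
        field_simp
        ring
    _ ≤ (1 + 2 * L) / k := by
        refine div_le_div_of_nonneg_right ?_ hk0.le
        linarith

/-- Iterating `d (n + 1) ≤ (1 - a) * d n + c * a ^ 2` from `d 0 ≤ c`. -/
lemma contracting_recursion_bound {d : ℕ → ℝ} {a c : ℝ} (ha : a ≤ 1) (h0 : d 0 ≤ c)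
    (hstep : ∀ n, d (n + 1) ≤ (1 - a) * d n + c * a ^ 2) (n : ℕ) :
    d n ≤ c * ((1 - a) ^ n + a * (1 - (1 - a) ^ n)) := by
  induction n with
  | zero => simpa using h0
  | succ n ih =>
    refine (hstep n).trans ?_
    have := mul_le_mul_of_nonneg_left ih (sub_nonneg.mpr ha)
    rw [pow_succ (1 - a) n]
    linarith

theorem frank_wolfe_fw_gap_optimized_constant_stepsize
    {E : Type*} [NormedAddCommGroup E] [NormedSpace ℝ E] [FiniteDimensional ℝ E]
    (Q : Set E) (hQne : Q.Nonempty) (hQcomp : IsCompact Q) (hQconv : Convex ℝ Q)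
    (U : Set E) (hUopen : IsOpen U) (hQU : Q ⊆ U)
    (h : E → ℝ) (hconc : ConcaveOn ℝ Set.univ h) (hdiff : DifferentiableOn ℝ h U)
    (hstar : ℝ) (hhstar : IsGreatest (h '' Q) hstar)
    (C : ℝ) (hC : 0 ≤ C)
    (hcurv : ∀ lam ∈ Q, ∀ lam' ∈ Q, ∀ a ∈ Set.Icc (0:ℝ) 1,
      h (lam + a • (lam' - lam)) ≥
        h lam + a * (fderiv ℝ h lam) (lam' - lam) - C / 2 * a ^ 2)
    (ab : ℕ → ℝ) (lam lamt : ℕ → E) (Bw G B : ℕ → ℝ)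
    (hab : ∀ k, 1 ≤ k → ab k ∈ Set.Ico (0:ℝ) 1)
    (hlam0 : lam 0 ∈ Q)
    (hlamtQ : ∀ k, lamt k ∈ Q)
    (hargmax : ∀ k, ∀ l ∈ Q,
      (fderiv ℝ h (lam k)) (l - lam k) ≤ (fderiv ℝ h (lam k)) (lamt k - lam k))
    (hBw : ∀ k, Bw k = h (lam k) + (fderiv ℝ h (lam k)) (lamt k - lam k))
    (hG : ∀ k, G k = (fderiv ℝ h (lam k)) (lamt k - lam k))
    (hprestart : lam 1 = lamt 0)
    (hnext : ∀ k, 1 ≤ k → lam (k+1) = lam k + ab k • (lamt k - lam k))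
    (hBlb : ∀ k, hstar ≤ B k)
    (hBmono : ∀ k, 1 ≤ k → B k ≤ B (k-1))
    (hBBw : ∀ k, B k ≤ Bw k)
    (k : ℕ) (hk : 1 ≤ k)
    (a : ℝ) (ha : a = 1 - 1 / (((k : ℝ) + 1) ^ ((1 : ℝ) / (k : ℝ))))
    (habval : ∀ i, 1 ≤ i → ab i = a)
    :
    (Finset.Icc 1 (2 * k + 1)).inf' (Finset.nonempty_Icc.mpr (by omega)) G ≤
      C / 2 * (1 + 2 * Real.log ((k : ℝ) + 1)) / (k : ℝ) := by
  have hmem : ∀ i, lam (i + 1) ∈ Q := by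
    intro i
    induction i with
    | zero => exact hprestart ▸ hlamtQ 0
    | succ i ih =>
      rw [hnext (i + 1) (by omega)]
      have h1 := hab (i + 1) (by omega)
      exact hQconv.add_smul_sub_mem ih (hlamtQ _) ⟨h1.1, h1.2.le⟩
  obtain ⟨hapos, hpow, hest⟩ := fw_constant_step_estimate k hk a ha
  have ha1 : a ≤ 1 := by
    have h1 := (hab 1 le_rfl).2
    rw [habval 1 le_rfl] at h1
    exact h1.le
  set c := C / 2 with hc
  have hc0 : 0 ≤ c := by positivity
  let d : ℕ → ℝ := fun i => hstar - h (lam (i + 1))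
  have hd0 : ∀ i, 0 ≤ d i := fun i => sub_nonneg.mpr (hhstar.2 ⟨_, hmem i, rfl⟩)
  have hdescent : ∀ i, d (i + 1) ≤ d i - a * G (i + 1) + c * a ^ 2 := by
    intro i
    have h1 := hcurv _ (hmem i) _ (hlamtQ (i + 1)) a ⟨hapos.le, ha1⟩
    have h2 := hnext (i + 1) (by omega)
    rw [habval _ (by omega)] at h2
    rw [← h2, ← hG] at h1
    simp only [d]
    linarith
  have hgap : ∀ i, d i ≤ G (i + 1) := by
    intro i
    have h1 := hBw (i + 1)
    have h2 := hBlb (i + 1)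
    have h3 := hBBw (i + 1)
    rw [← hG] at h1
    simp only [d]
    linarith
  have hinit : d 0 ≤ c := by
    have h1 := hcurv _ hlam0 _ (hlamtQ 0) 1 ⟨zero_le_one, le_rfl⟩
    rw [one_smul, add_sub_cancel, ← hprestart] at h1
    have h2 := hBw 0
    rw [← hprestart] at h2
    have h3 := hBlb 0
    have h4 := hBBw 0
    simp only [d, zero_add]
    linarith
  have hrec : ∀ i, d (i + 1) ≤ (1 - a) * d i + c * a ^ 2 := by
    intro i
    have h1 := mul_le_mul_of_nonneg_left (hgap i) hapos.le
    linarith [hdescent i]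
  have hdk := contracting_recursion_bound ha1 hinit hrec k
  rw [hpow] at hdk
  set m := (Finset.Icc 1 (2 * k + 1)).inf' (Finset.nonempty_Icc.mpr (by omega)) G with hm
  have hmG : ∀ i, i ≤ 2 * k → m ≤ G (i + 1) := fun i hi =>
    Finset.inf'_le _ (Finset.mem_Icc.mpr ⟨by omega, by omega⟩)
  have htel : ∀ n, n ≤ k + 1 → d (k + n) ≤ d k - n * (a * m) + n * (c * a ^ 2) := by
    intro n
    induction n with
    | zero => intro _; simp
    | succ n ih =>
      intro hn
      have h1 := ih (by omega)
      have h2 := hdescent (k + n)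
      have h3 := mul_le_mul_of_nonneg_left (hmG (k + n) (by omega)) hapos.le
      rw [← add_assoc]
      push_cast
      linarith
  have hlast := htel (k + 1) le_rfl
  push_cast at hlast
  have hk1 : (0 : ℝ) < (k : ℝ) + 1 := by positivity
  have hkey : ((k : ℝ) + 1) * a * m ≤
      c * (1 / ((k : ℝ) + 1) + a * (1 - 1 / ((k : ℝ) + 1))) + (k + 1) * (c * a ^ 2) := by
    linarith [hd0 (k + (k + 1))]
  calc m ≤ c * (1 / (((k : ℝ) + 1) ^ 2 * a) + k / ((k : ℝ) + 1) ^ 2 + a) := by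
        refine le_of_mul_le_mul_left (hkey.trans_eq ?_) (mul_pos hk1 hapos)
        field_simp
        ring
    _ ≤ c * ((1 + 2 * Real.log ((k : ℝ) + 1)) / k) := mul_le_mul_of_nonneg_left hest hc0
    _ = c * (1 + 2 * Real.log ((k : ℝ) + 1)) / k := by rw [mul_div_assoc]
end

section
/- Let {λ_k}, {λ̃_k}, {B^w_k}, {G_k}, {B_k} be a Frank–Wolfe iterate sequence started at λ_1 ∈ Q with B_1 > h(λ_1), let C₁ > 0 be a given estimate of the curvature constant, and use the warm-start step sizes ᾱ_i = 2/( 2C₁/(B_1 − h(λ_1)) + i + 1 ) for i ≥ 1. If C ≥ 0 is a curvature bound for (h,Q), then for all k ≥ 1: B_k − h(λ_{k+1}) ≤ 2·max{C₁, C} / ( 2C₁/(B_1 − h(λ_1)) + k ). -/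
/-- One step of the recursion `e ↦ (1 - a) * e + C / 2 * a ^ 2` with `a = 2 / (t + 1)` preserves
the rate `2 * M / (t - 1)`, which becomes `2 * M / t`. -/
lemma one_sub_mul_add_sq_le_two_mul_div {t M C e a : ℝ} (ht : 1 < t) (hM : 0 ≤ M) (hCM : C ≤ M)
    (he : e ≤ 2 * M / (t - 1)) (ha : a = 2 / (t + 1)) :
    (1 - a) * e + C / 2 * a ^ 2 ≤ 2 * M / t := by
  have ht' : 0 < t - 1 := by linarith
  have ha1 : 1 - a = (t - 1) / (t + 1) := by
    rw [ha]
    field_simp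
    ring
  have ha0 : 0 ≤ 1 - a := by
    rw [ha1]
    positivity
  calc (1 - a) * e + C / 2 * a ^ 2 ≤ (1 - a) * (2 * M / (t - 1)) + M / 2 * a ^ 2 := by gcongr
    _ = 2 * M * ((t + 2) / (t + 1) ^ 2) := by
      rw [ha1, ha]
      field_simp
      ring
    _ ≤ 2 * M * (1 / t) := by
      refine mul_le_mul_of_nonneg_left ?_ (by positivity)
      rw [div_le_div_iff₀ (by positivity) (by positivity)]
      nlinarith
    _ = 2 * M / t := by ring


theorem frank_wolfe_bound_gap_warm_start_stepsize
    {E : Type*} [NormedAddCommGroup E] [NormedSpace ℝ E] [FiniteDimensional ℝ E]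
    (Q : Set E) (hQne : Q.Nonempty) (hQcomp : IsCompact Q) (hQconv : Convex ℝ Q)
    (U : Set E) (hUopen : IsOpen U) (hQU : Q ⊆ U)
    (h : E → ℝ) (hconc : ConcaveOn ℝ Set.univ h) (hdiff : DifferentiableOn ℝ h U)
    (hstar : ℝ) (hhstar : IsGreatest (h '' Q) hstar)
    (C : ℝ) (hC : 0 ≤ C)
    (hcurv : ∀ lam ∈ Q, ∀ lam' ∈ Q, ∀ a ∈ Set.Icc (0:ℝ) 1,
      h (lam + a • (lam' - lam)) ≥
        h lam + a * (fderiv ℝ h lam) (lam' - lam) - C / 2 * a ^ 2)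
    (ab : ℕ → ℝ) (lam lamt : ℕ → E) (Bw G B : ℕ → ℝ)
    (hab : ∀ k, 1 ≤ k → ab k ∈ Set.Ico (0:ℝ) 1)
    (hlam1 : lam 1 ∈ Q)
    (hlamtQ : ∀ k, 1 ≤ k → lamt k ∈ Q)
    (hargmax : ∀ k, 1 ≤ k → ∀ l ∈ Q,
      (fderiv ℝ h (lam k)) (l - lam k) ≤ (fderiv ℝ h (lam k)) (lamt k - lam k))
    (hBw : ∀ k, 1 ≤ k → Bw k = h (lam k) + (fderiv ℝ h (lam k)) (lamt k - lam k))
    (hG : ∀ k, 1 ≤ k → G k = (fderiv ℝ h (lam k)) (lamt k - lam k))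
    (hnext : ∀ k, 1 ≤ k → lam (k+1) = lam k + ab k • (lamt k - lam k))
    (hBlb : ∀ k, hstar ≤ B k)
    (hBmono : ∀ k, 2 ≤ k → B k ≤ B (k-1))
    (hBBw : ∀ k, 1 ≤ k → B k ≤ Bw k)
    (C1 : ℝ) (hC1 : 0 < C1)
    (hB1 : h (lam 1) < B 1)
    (habval : ∀ i, 1 ≤ i →
      ab i = 2 / (2 * C1 / (B 1 - h (lam 1)) + (i : ℝ) + 1))
    :
    ∀ k, 1 ≤ k → B k - h (lam (k+1)) ≤
      2 * max C1 C / (2 * C1 / (B 1 - h (lam 1)) + (k : ℝ)) := by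
  have hD : 0 < B 1 - h (lam 1) := sub_pos.mpr hB1
  set s := 2 * C1 / (B 1 - h (lam 1)) with hs
  have hs0 : 0 < s := by positivity
  have hM : 0 ≤ max C1 C := hC.trans (le_max_right _ _)
  have step : ∀ k, 1 ≤ k → lam k ∈ Q → B k - h (lam k) ≤ 2 * max C1 C / (s + k - 1) →
      B k - h (lam (k + 1)) ≤ 2 * max C1 C / (s + k) := by
    intro k hk hmem he
    have hk' : (1 : ℝ) ≤ k := by exact_mod_cast hk
    have hcurv_k := hcurv _ hmem _ (hlamtQ k hk) (ab k) (Set.Ico_subset_Icc_self (hab k hk))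
    rw [← hnext k hk] at hcurv_k
    have hgap : B k - h (lam k) ≤ fderiv ℝ h (lam k) (lamt k - lam k) := by
      linarith [hBBw k hk, hBw k hk]
    have hmul := mul_le_mul_of_nonneg_left hgap (hab k hk).1
    have hrate := one_sub_mul_add_sq_le_two_mul_div (by linarith) hM (le_max_right C1 C) he
      (habval k hk)
    linarith
  have inv : ∀ k, 1 ≤ k → lam k ∈ Q ∧ B k - h (lam k) ≤ 2 * max C1 C / (s + k - 1) := by
    intro k hk
    induction k, hk using Nat.le_induction with
    | base =>
      refine ⟨hlam1, ?_⟩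
      rw [Nat.cast_one, add_sub_cancel_right, le_div_iff₀ hs0, hs, mul_div_cancel₀ _ hD.ne']
      linarith [le_max_left C1 C]
    | succ k hk ih =>
      refine ⟨?_, ?_⟩
      · rw [hnext k hk]
        exact hQconv.add_smul_sub_mem ih.1 (hlamtQ k hk) (Set.Ico_subset_Icc_self (hab k hk))
      · have hB := hBmono (k + 1) (by omega)
        rw [Nat.add_sub_cancel] at hB
        rw [Nat.cast_succ, ← add_assoc, add_sub_cancel_right]
        linarith [step k hk ih.1 ih.2]
  intro k hk
  exact step k hk (inv k hk).1 (inv k hk).2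
end

section
/- Consider the Frank–Wolfe method with dynamic step sizes: given λ_1 ∈ Q and C_0 > 0, for each k ≥ 1 let λ̃_k ∈ argmax_{λ∈Q}{ h(λ_k) + ∇h(λ_k)(λ − λ_k) }, B^w_k := h(λ_k) + ∇h(λ_k)(λ̃_k − λ_k), let B_k satisfy h* ≤ B_k ≤ min{B_{k−1}, B^w_k} and B_k > h(λ_k), and let C_k > 0 satisfy (i) C_k ≥ C_{k−1} and (ii) h(λ_k + ᾱ_k(λ̃_k − λ_k)) ≥ h(λ_k) + ᾱ_k(B_k − h(λ_k)) − (C_k/2)ᾱ_k², where ᾱ_k := 2/( 2C_k/(B_k − h(λ_k)) + 2 ); finally set λ_{k+1} := λ_k + ᾱ_k(λ̃_k − λ_k). Then for every k ≥ 1 and every ℓ ∈ {1,…,k}: B_k − h(λ_k) ≤ 2C_k / ( 2C_k/(B_ℓ − h(λ_ℓ)) + k − ℓ ). -/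
/-- One step of the gap recursion: the step size `g / (C + g)` increases the inverse gap by at
least `1 / (2 * C)`. -/
theorem inv_add_inv_le_inv_of_step {C g g' a : ℝ} (hC : 0 < C) (hg : 0 < g) (hg' : 0 < g')
    (ha : a = 2 / (2 * C / g + 2)) (hstep : g' ≤ g - a * g + C / 2 * a ^ 2) :
    1 / g + 1 / (2 * C) ≤ 1 / g' := by
  have ha' : a = g / (C + g) := by
    rw [ha]
    field_simp
  have hbound : g' ≤ 2 * C * g / (2 * C + g) := by
    refine hstep.trans ?_
    have hdiff : 2 * C * g / (2 * C + g) - (g - a * g + C / 2 * a ^ 2)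
        = C * g ^ 3 / (2 * (C + g) ^ 2 * (2 * C + g)) := by
      rw [ha']
      field_simp
      ring
    have hnonneg : 0 ≤ C * g ^ 3 / (2 * (C + g) ^ 2 * (2 * C + g)) := by positivity
    linarith
  calc 1 / g + 1 / (2 * C) = 1 / (2 * C * g / (2 * C + g)) := by field_simp
    _ ≤ 1 / g' := one_div_le_one_div_of_le hg' hbound


theorem frank_wolfe_bound_gap_dynamic_stepsize
    {E : Type*} [NormedAddCommGroup E] [NormedSpace ℝ E] [FiniteDimensional ℝ E]
    (Q : Set E) (hQne : Q.Nonempty) (hQcomp : IsCompact Q) (hQconv : Convex ℝ Q)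
    (U : Set E) (hUopen : IsOpen U) (hQU : Q ⊆ U)
    (h : E → ℝ) (hconc : ConcaveOn ℝ Set.univ h) (hdiff : DifferentiableOn ℝ h U)
    (hstar : ℝ) (hhstar : IsGreatest (h '' Q) hstar)
    (ab : ℕ → ℝ) (lam lamt : ℕ → E) (Bw B Ck : ℕ → ℝ)
    (hC0 : 0 < Ck 0)
    (hlam1 : lam 1 ∈ Q)
    (hlamtQ : ∀ k, 1 ≤ k → lamt k ∈ Q)
    (hargmax : ∀ k, 1 ≤ k → ∀ l ∈ Q,
      (fderiv ℝ h (lam k)) (l - lam k) ≤ (fderiv ℝ h (lam k)) (lamt k - lam k))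
    (hBw : ∀ k, 1 ≤ k → Bw k = h (lam k) + (fderiv ℝ h (lam k)) (lamt k - lam k))
    (hBlb : ∀ k, 1 ≤ k → hstar ≤ B k)
    (hBmono : ∀ k, 2 ≤ k → B k ≤ B (k-1))
    (hBBw : ∀ k, 1 ≤ k → B k ≤ Bw k)
    (hBgap : ∀ k, 1 ≤ k → h (lam k) < B k)
    (hCpos : ∀ k, 0 < Ck k)
    (hCmono : ∀ k, 1 ≤ k → Ck (k-1) ≤ Ck k)
    (habval : ∀ k, 1 ≤ k → ab k = 2 / (2 * Ck k / (B k - h (lam k)) + 2))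
    (hCcond : ∀ k, 1 ≤ k →
      h (lam k + ab k • (lamt k - lam k)) ≥
        h (lam k) + ab k * (B k - h (lam k)) - Ck k / 2 * ab k ^ 2)
    (hnext : ∀ k, 1 ≤ k → lam (k+1) = lam k + ab k • (lamt k - lam k))
    :
    ∀ k, 1 ≤ k → ∀ l, 1 ≤ l → l ≤ k →
      B k - h (lam k) ≤
        2 * Ck k / (2 * Ck k / (B l - h (lam l)) + (k : ℝ) - (l : ℝ)) := by
  intro k _ l hl hlk
  have hpos : ∀ j, 1 ≤ j → 0 < B j - h (lam j) := fun j hj => sub_pos.mpr (hBgap j hj)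
  have hstep : ∀ j, 1 ≤ j →
      1 / (B j - h (lam j)) + 1 / (2 * Ck j) ≤ 1 / (B (j + 1) - h (lam (j + 1))) := by
    intro j hj
    refine inv_add_inv_le_inv_of_step (hCpos j) (hpos j hj) (hpos (j + 1) (by omega))
      (habval j hj) ?_
    have hB : B (j + 1) ≤ B j := hBmono (j + 1) (by omega)
    have hh := hCcond j hj
    rw [← hnext j hj] at hh
    linarith
  have hinv : 1 / (B l - h (lam l)) + ((k : ℝ) - l) / (2 * Ck k) ≤ 1 / (B k - h (lam k)) := by
    induction k, hlk using Nat.le_induction with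
    | base => simp
    | succ n hn ih =>
      have hC : Ck n ≤ Ck (n + 1) := hCmono (n + 1) (by omega)
      have hCn := hCpos n
      have hln : (l : ℝ) ≤ n := by exact_mod_cast hn
      have hmono : ((n : ℝ) - l + 1) / (2 * Ck (n + 1)) ≤ ((n : ℝ) - l + 1) / (2 * Ck n) :=
        div_le_div_of_nonneg_left (by linarith) (by linarith) (by linarith)
      have hsplit : ((n : ℝ) - l + 1) / (2 * Ck n)
          = ((n : ℝ) - l) / (2 * Ck n) + 1 / (2 * Ck n) := add_div _ _ _
      have hcast : ((n + 1 : ℕ) : ℝ) - l = (n : ℝ) - l + 1 := by push_cast; ring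
      rw [hcast]
      linarith [ih (by omega), hstep n (by omega)]
  have hCk := hCpos k
  have hgk := hpos k (by omega)
  have hgl := hpos l hl
  have hlk' : (l : ℝ) ≤ k := by exact_mod_cast hlk
  have hden : 0 < 2 * Ck k / (B l - h (lam l)) + (k : ℝ) - l := by
    have : 0 < 2 * Ck k / (B l - h (lam l)) := by positivity
    linarith
  rw [le_div_iff₀ hden, mul_comm, ← le_div_iff₀ hgk]
  calc 2 * Ck k / (B l - h (lam l)) + (k : ℝ) - l
      = 2 * Ck k * (1 / (B l - h (lam l)) + ((k : ℝ) - l) / (2 * Ck k)) := by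
        field_simp
        ring
    _ ≤ 2 * Ck k * (1 / (B k - h (lam k))) := by gcongr
    _ = 2 * Ck k / (B k - h (lam k)) := mul_one_div _ _
end

section
/- Let {λ_k}, {λ̃_k}, {B^w_k}, {G_k}, {B_k} be a Frank–Wolfe iterate sequence with δ_k-approximate subproblem solutions and step sizes {ᾱ_k} ⊆ [0,1), let C ≥ 0 be a curvature bound for (h,Q), and let {α_k}, {β_k} be the associated dual-averages sequences. Then for every k ≥ 0: B_k − h(λ_{k+1}) ≤ (B_k − h(λ_1))/β_{k+1} + ( (C/2) · Σ_{i=1}^{k} α_i²/β_{i+1} ) / β_{k+1} + ( Σ_{i=1}^{k} α_i·δ_i ) / β_{k+1}. -/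
theorem frank_wolfe_bound_gap_approximate_subproblems
    {E : Type*} [NormedAddCommGroup E] [NormedSpace ℝ E] [FiniteDimensional ℝ E]
    (Q : Set E) (hQne : Q.Nonempty) (hQcomp : IsCompact Q) (hQconv : Convex ℝ Q)
    (U : Set E) (hUopen : IsOpen U) (hQU : Q ⊆ U)
    (h : E → ℝ) (hconc : ConcaveOn ℝ Set.univ h) (hdiff : DifferentiableOn ℝ h U)
    (hstar : ℝ) (hhstar : IsGreatest (h '' Q) hstar)
    (C : ℝ) (hC : 0 ≤ C)
    (hcurv : ∀ lam ∈ Q, ∀ lam' ∈ Q, ∀ a ∈ Set.Icc (0:ℝ) 1,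
      h (lam + a • (lam' - lam)) ≥
        h lam + a * (fderiv ℝ h lam) (lam' - lam) - C / 2 * a ^ 2)
    (ab delta : ℕ → ℝ) (lam lamt : ℕ → E) (Bw G B : ℕ → ℝ)
    (hab : ∀ k, 1 ≤ k → ab k ∈ Set.Ico (0:ℝ) 1)
    (hdelta : ∀ k, 1 ≤ k → 0 ≤ delta k)
    (hlam1 : lam 1 ∈ Q)
    (hlamtQ : ∀ k, 1 ≤ k → lamt k ∈ Q)
    (happrox : ∀ k, 1 ≤ k → ∀ l ∈ Q,
      (fderiv ℝ h (lam k)) l - delta k ≤ (fderiv ℝ h (lam k)) (lamt k))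
    (hBw : ∀ k, 1 ≤ k →
      Bw k = h (lam k) + (fderiv ℝ h (lam k)) (lamt k - lam k) + delta k)
    (hG : ∀ k, 1 ≤ k → G k = (fderiv ℝ h (lam k)) (lamt k - lam k) + delta k)
    (hnext : ∀ k, 1 ≤ k → lam (k+1) = lam k + ab k • (lamt k - lam k))
    (hBlb : ∀ k, hstar ≤ B k)
    (hBmono : ∀ k, 1 ≤ k → B k ≤ B (k-1))
    (hBBw : ∀ k, 1 ≤ k → B k ≤ Bw k)
    (alpha beta : ℕ → ℝ)
    (hbeta : ∀ k, 1 ≤ k → beta k = (∏ j ∈ Finset.Icc 1 (k-1), (1 - ab j))⁻¹)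
    (halpha : ∀ k, 1 ≤ k → alpha k = beta k * ab k / (1 - ab k))
    :
    ∀ k : ℕ, B k - h (lam (k+1)) ≤ (B k - h (lam 1)) / beta (k+1)
      + (C / 2 * ∑ i ∈ Finset.Icc 1 k, alpha i ^ 2 / beta (i+1)) / beta (k+1)
      + (∑ i ∈ Finset.Icc 1 k, alpha i * delta i) / beta (k+1) := by
  have hmem : ∀ k, lam (k + 1) ∈ Q := by
    intro k
    induction k with
    | zero => exact hlam1
    | succ k ih =>
      rw [hnext (k + 1) (by omega)]
      have ha := hab (k + 1) (by omega)
      exact hQconv.add_smul_sub_mem ih (hlamtQ (k + 1) (by omega)) ⟨ha.1, ha.2.le⟩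
  have hbeta_one : beta 1 = 1 := by simp [hbeta 1 le_rfl]
  have hbeta_succ : ∀ k, beta (k + 2) = beta (k + 1) / (1 - ab (k + 1)) := by
    intro k
    rw [hbeta (k + 2) (by omega), hbeta (k + 1) (by omega),
      show k + 2 - 1 = k + 1 from rfl, Nat.add_sub_cancel,
      Finset.prod_Icc_succ_top (by omega), mul_inv, div_eq_mul_inv]
  have hbeta_pos : ∀ k, 0 < beta (k + 1) := by
    intro k
    rw [hbeta (k + 1) (by omega)]
    refine inv_pos.mpr (Finset.prod_pos fun j hj => ?_)
    have := (hab j (Finset.mem_Icc.mp hj).1).2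
    linarith
  have key : ∀ k b, b ≤ B k → beta (k + 1) * (b - h (lam (k + 1))) ≤ b - h (lam 1)
      + C / 2 * ∑ i ∈ Finset.Icc 1 k, alpha i ^ 2 / beta (i + 1)
      + ∑ i ∈ Finset.Icc 1 k, alpha i * delta i := by
    intro k
    induction k with
    | zero => intro b _; simp [hbeta_one]
    | succ k ih =>
      intro b hb
      have hk : 1 ≤ k + 1 := by omega
      have ih' := ih b (hb.trans (hBmono (k + 1) hk))
      have hb' := hb.trans (hBBw (k + 1) hk)
      rw [hBw (k + 1) hk] at hb'
      have ha := hab (k + 1) hk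
      have hc := hcurv _ (hmem k) _ (hlamtQ (k + 1) hk) _ ⟨ha.1, ha.2.le⟩
      rw [← hnext (k + 1) hk] at hc
      have hstep : b - h (lam (k + 1 + 1)) ≤ (1 - ab (k + 1)) * (b - h (lam (k + 1)))
          + C / 2 * ab (k + 1) ^ 2 + ab (k + 1) * delta (k + 1) := by
        nlinarith [mul_le_mul_of_nonneg_left hb' ha.1]
      have hne : 1 - ab (k + 1) ≠ 0 := (sub_pos.mpr ha.2).ne'
      have hpos : 0 < beta (k + 1 + 1) := hbeta_pos (k + 1)
      have hβ : beta (k + 1) = beta (k + 1 + 1) * (1 - ab (k + 1)) := by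
        rw [hbeta_succ k, div_mul_cancel₀ _ hne]
      have hα : alpha (k + 1) = beta (k + 1 + 1) * ab (k + 1) := by
        rw [halpha (k + 1) hk, hβ]
        field_simp
      have hα_sq : alpha (k + 1) ^ 2 / beta (k + 1 + 1)
          = beta (k + 1 + 1) * ab (k + 1) ^ 2 := by
        rw [hα]
        field_simp
      rw [Finset.sum_Icc_succ_top hk, Finset.sum_Icc_succ_top hk, hα_sq, hα]
      rw [hβ] at ih'
      linarith [mul_le_mul_of_nonneg_left hstep hpos.le]
  intro k
  rw [← add_div, ← add_div, le_div_iff₀ (hbeta_pos k), mul_comm]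
  exact key k (B k) le_rfl
end

section
/- Let {λ_k}, {λ̃_k}, {B^w_k}, {G_k}, {B_k} be a Frank–Wolfe iterate sequence with δ_k-approximate subproblem solutions and step sizes {ᾱ_k} ⊆ [0,1), let C ≥ 0 be a curvature bound for (h,Q), and let {α_k}, {β_k} be the associated dual-averages sequences. Then for every ℓ ≥ 0 and every k ≥ ℓ + 1 with Σ_{i=ℓ+1}^{k} ᾱ_i > 0: min_{i∈{ℓ+1,…,k}} G_i ≤ (1/Σ_{i=ℓ+1}^{k} ᾱ_i) · [ (B_ℓ − h(λ_1))/β_{ℓ+1} + ( (C/2)·Σ_{i=1}^{ℓ} α_i²/β_{i+1} ) / β_{ℓ+1} + ( Σ_{i=1}^{ℓ} α_i·δ_i ) / β_{ℓ+1} ] + ( (C/2)·Σ_{i=ℓ+1}^{k} ᾱ_i² ) / ( Σ_{i=ℓ+1}^{k} ᾱ_i ) + ( Σ_{i=ℓ+1}^{k} ᾱ_i·δ_i ) / ( Σ_{i=ℓ+1}^{k} ᾱ_i ). -/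
/-- Weighted telescoping: if `d` contracts by the factor `1 - a i` up to an error `a i * e i + c * a i ^ 2`
and the weights satisfy `b (i + 1) * (1 - a i) = b i`, then the errors accumulate additively in `b i * d i`. -/
theorem weighted_contraction_le_add_sum (a b e d : ℕ → ℝ) (c : ℝ) (l : ℕ)
    (hb : ∀ i, 1 ≤ i → 0 < b i) (hbs : ∀ i, 1 ≤ i → b (i + 1) * (1 - a i) = b i)
    (hd : ∀ i, 1 ≤ i → i ≤ l → d (i + 1) ≤ (1 - a i) * d i + a i * e i + c * a i ^ 2) :
    b (l + 1) * d (l + 1) ≤ b 1 * d 1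
      + c * ∑ i ∈ Finset.Icc 1 l, (b (i + 1) * a i) ^ 2 / b (i + 1)
      + ∑ i ∈ Finset.Icc 1 l, b (i + 1) * a i * e i := by
  induction l with
  | zero => simp
  | succ n ih =>
    have ih' := ih fun i h1 h2 => hd i h1 (by omega)
    have hpos := hb (n + 1 + 1) (by omega)
    have hstep := mul_le_mul_of_nonneg_left (hd (n + 1) (by omega) le_rfl) hpos.le
    have hsq : (b (n + 1 + 1) * a (n + 1)) ^ 2 / b (n + 1 + 1)
        = b (n + 1 + 1) * a (n + 1) ^ 2 := by
      field_simp
    rw [Finset.sum_Icc_succ_top (by omega), Finset.sum_Icc_succ_top (by omega), hsq]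
    have hw : b (n + 1 + 1) * (1 - a (n + 1)) * d (n + 1) = b (n + 1) * d (n + 1) := by
      rw [hbs (n + 1) (by omega)]
    linarith

/-- Telescoping of an ascent inequality over `l + 1, …, k`. -/
theorem sum_mul_le_of_ascent (a e g f : ℕ → ℝ) (c : ℝ) {l k : ℕ} (hlk : l ≤ k)
    (hf : ∀ i, 1 ≤ i → f i + a i * g i - a i * e i - c * a i ^ 2 ≤ f (i + 1)) :
    ∑ i ∈ Finset.Icc (l + 1) k, a i * g i ≤ f (k + 1) - f (l + 1)
      + c * ∑ i ∈ Finset.Icc (l + 1) k, a i ^ 2 + ∑ i ∈ Finset.Icc (l + 1) k, a i * e i := by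
  induction k, hlk using Nat.le_induction with
  | base => simp
  | succ n hn ih =>
    have hstep := hf (n + 1) (by omega)
    simp only [Finset.sum_Icc_succ_top (show l + 1 ≤ n + 1 by omega)]
    linarith


theorem frank_wolfe_fw_gap_approximate_subproblems
    {E : Type*} [NormedAddCommGroup E] [NormedSpace ℝ E] [FiniteDimensional ℝ E]
    (Q : Set E) (hQne : Q.Nonempty) (hQcomp : IsCompact Q) (hQconv : Convex ℝ Q)
    (U : Set E) (hUopen : IsOpen U) (hQU : Q ⊆ U)
    (h : E → ℝ) (hconc : ConcaveOn ℝ Set.univ h) (hdiff : DifferentiableOn ℝ h U)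
    (hstar : ℝ) (hhstar : IsGreatest (h '' Q) hstar)
    (C : ℝ) (hC : 0 ≤ C)
    (hcurv : ∀ lam ∈ Q, ∀ lam' ∈ Q, ∀ a ∈ Set.Icc (0:ℝ) 1,
      h (lam + a • (lam' - lam)) ≥
        h lam + a * (fderiv ℝ h lam) (lam' - lam) - C / 2 * a ^ 2)
    (ab delta : ℕ → ℝ) (lam lamt : ℕ → E) (Bw G B : ℕ → ℝ)
    (hab : ∀ k, 1 ≤ k → ab k ∈ Set.Ico (0:ℝ) 1)
    (hdelta : ∀ k, 1 ≤ k → 0 ≤ delta k)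
    (hlam1 : lam 1 ∈ Q)
    (hlamtQ : ∀ k, 1 ≤ k → lamt k ∈ Q)
    (happrox : ∀ k, 1 ≤ k → ∀ l ∈ Q,
      (fderiv ℝ h (lam k)) l - delta k ≤ (fderiv ℝ h (lam k)) (lamt k))
    (hBw : ∀ k, 1 ≤ k →
      Bw k = h (lam k) + (fderiv ℝ h (lam k)) (lamt k - lam k) + delta k)
    (hG : ∀ k, 1 ≤ k → G k = (fderiv ℝ h (lam k)) (lamt k - lam k) + delta k)
    (hnext : ∀ k, 1 ≤ k → lam (k+1) = lam k + ab k • (lamt k - lam k))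
    (hBlb : ∀ k, hstar ≤ B k)
    (hBmono : ∀ k, 1 ≤ k → B k ≤ B (k-1))
    (hBBw : ∀ k, 1 ≤ k → B k ≤ Bw k)
    (alpha beta : ℕ → ℝ)
    (hbeta : ∀ k, 1 ≤ k → beta k = (∏ j ∈ Finset.Icc 1 (k-1), (1 - ab j))⁻¹)
    (halpha : ∀ k, 1 ≤ k → alpha k = beta k * ab k / (1 - ab k))
    :
    ∀ (l k : ℕ) (hlk : l + 1 ≤ k),
      0 < ∑ i ∈ Finset.Icc (l+1) k, ab i →
      (Finset.Icc (l+1) k).inf' (Finset.nonempty_Icc.mpr hlk) G ≤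
        (1 / ∑ i ∈ Finset.Icc (l+1) k, ab i) *
          ((B l - h (lam 1)) / beta (l+1)
            + (C / 2 * ∑ i ∈ Finset.Icc 1 l, alpha i ^ 2 / beta (i+1)) / beta (l+1)
            + (∑ i ∈ Finset.Icc 1 l, alpha i * delta i) / beta (l+1))
        + (C / 2 * ∑ i ∈ Finset.Icc (l+1) k, ab i ^ 2) / (∑ i ∈ Finset.Icc (l+1) k, ab i)
        + (∑ i ∈ Finset.Icc (l+1) k, ab i * delta i) / (∑ i ∈ Finset.Icc (l+1) k, ab i) := by
  intro l k hlk hsum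
  have hQ : ∀ i, 1 ≤ i → lam i ∈ Q := by
    intro i hi
    induction i, hi using Nat.le_induction with
    | base => exact hlam1
    | succ n hn ih =>
      rw [hnext n hn]
      exact hQconv.add_smul_sub_mem ih (hlamtQ n hn) ⟨(hab n hn).1, (hab n hn).2.le⟩
  have hasc : ∀ i, 1 ≤ i →
      h (lam i) + ab i * G i - ab i * delta i - C / 2 * ab i ^ 2 ≤ h (lam (i + 1)) := by
    intro i hi
    have hc := hcurv _ (hQ i hi) _ (hlamtQ i hi) (ab i) ⟨(hab i hi).1, (hab i hi).2.le⟩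
    rw [← hnext i hi] at hc
    rw [hG i hi]
    linarith
  have hB : ∀ i, i ≤ l → B l ≤ B i := by
    intro i hi
    exact antitone_nat_of_succ_le (fun n => by simpa using hBmono (n + 1) (by omega)) hi
  have hbpos : ∀ i, 1 ≤ i → 0 < beta i := by
    intro i hi
    rw [hbeta i hi]
    refine inv_pos.mpr (Finset.prod_pos fun j hj => ?_)
    linarith [(hab j (Finset.mem_Icc.mp hj).1).2]
  have hbs : ∀ i, 1 ≤ i → beta (i + 1) * (1 - ab i) = beta i := by
    intro i hi
    have hne : 1 - ab i ≠ 0 := by linarith [(hab i hi).2]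
    obtain ⟨n, rfl⟩ := Nat.exists_eq_add_of_le' hi
    rw [hbeta _ hi, hbeta (n + 1 + 1) (by omega), Nat.add_sub_cancel, Nat.add_sub_cancel,
      Finset.prod_Icc_succ_top (by omega), mul_inv, mul_assoc, inv_mul_cancel₀ hne, mul_one]
  have halpha' : ∀ i, 1 ≤ i → alpha i = beta (i + 1) * ab i := by
    intro i hi
    have hne : 1 - ab i ≠ 0 := by linarith [(hab i hi).2]
    rw [halpha i hi, ← hbs i hi]
    field_simp
  have hhead := weighted_contraction_le_add_sum ab beta delta (fun i => B l - h (lam i)) (C / 2) l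
    hbpos hbs (by
      intro i hi hil
      have hgap : B l - h (lam i) ≤ G i := by
        have h1 := hB i hil
        have h2 := hBBw i hi
        rw [hBw i hi] at h2
        rw [hG i hi]
        linarith
      have hmul := mul_le_mul_of_nonneg_left hgap (hab i hi).1
      linarith [hasc i hi])
  have hsq : ∑ i ∈ Finset.Icc 1 l, (beta (i + 1) * ab i) ^ 2 / beta (i + 1)
      = ∑ i ∈ Finset.Icc 1 l, alpha i ^ 2 / beta (i + 1) :=
    Finset.sum_congr rfl fun i hi => by rw [halpha' i (Finset.mem_Icc.mp hi).1]
  have hlin : ∑ i ∈ Finset.Icc 1 l, beta (i + 1) * ab i * delta i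
      = ∑ i ∈ Finset.Icc 1 l, alpha i * delta i :=
    Finset.sum_congr rfl fun i hi => by rw [halpha' i (Finset.mem_Icc.mp hi).1]
  have hbeta1 : beta 1 = 1 := by simp [hbeta 1 le_rfl]
  rw [hsq, hlin, hbeta1, one_mul, mul_comm, ← le_div_iff₀ (hbpos (l + 1) (by omega)),
    add_div, add_div] at hhead
  have htail := sum_mul_le_of_ascent ab delta G (fun i => h (lam i)) (C / 2)
    (show l ≤ k by omega) hasc
  have hmin : (∑ i ∈ Finset.Icc (l + 1) k, ab i)
      * (Finset.Icc (l + 1) k).inf' (Finset.nonempty_Icc.mpr hlk) G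
      ≤ ∑ i ∈ Finset.Icc (l + 1) k, ab i * G i := by
    rw [Finset.sum_mul]
    refine Finset.sum_le_sum fun i hi => mul_le_mul_of_nonneg_left (Finset.inf'_le G hi) ?_
    exact (hab i (by have := (Finset.mem_Icc.mp hi).1; omega)).1
  have hstar_le : h (lam (k + 1)) ≤ B l :=
    (hhstar.2 ⟨_, hQ (k + 1) (by omega), rfl⟩).trans (hBlb l)
  rw [one_div_mul_eq_div, ← add_div, ← add_div, le_div_iff₀ hsum, mul_comm]
  linarith
end

section
/- Consider the Frank–Wolfe method with a (δ_k, L_k)-oracle: given λ_1 ∈ Q, step sizes {ᾱ_k} ⊆ [0,1), and for each k ≥ 1 a pair (h_k, g_k) ∈ ℝ × E* satisfying h(λ) ≤ h_k + g_k(λ − λ_k) and h(λ) ≥ h_k + g_k(λ − λ_k) − (L_k/2)·‖λ − λ_k‖² − δ_k for all λ ∈ Q; let λ̃_k ∈ argmax_{λ∈Q}{ h_k + g_k(λ − λ_k) }, B^w_k := h_k + g_k(λ̃_k − λ_k), λ_{k+1} := λ_k + ᾱ_k(λ̃_k − λ_k), and let B_k satisfy h* ≤ B_k ≤ min{B_{k−1},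 B^w_k}. Let {α_k}, {β_k} be the dual-averages sequences associated with {ᾱ_k} and let Diam_Q := max_{λ,λ̄∈Q} ‖λ − λ̄‖. Then for every k ≥ 0: B_k − h(λ_{k+1}) ≤ (B_k − h(λ_1))/β_{k+1} + ( (Diam_Q²/2) · Σ_{i=1}^{k} L_i·α_i²/β_{i+1} ) / β_{k+1} + ( Σ_{i=1}^{k} β_{i+1}·δ_i ) / β_{k+1}. -/
/-- One step of a Frank-Wolfe iteration with an inexact second-order oracle: the progress made by
moving from `x` towards the maximizer `y` of the linear model `c + g (· - x)`. -/
lemma frank_wolfe_step {E : Type*} [NormedAddCommGroup E] [NormedSpace ℝ E]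
    {Q : Set E} (hQ : Convex ℝ Q) {h : E → ℝ} {x y : E} (hx : x ∈ Q) (hy : y ∈ Q)
    {a : ℝ} (ha0 : 0 ≤ a) (ha1 : a ≤ 1) {c L δ D b : ℝ} {g : E →L[ℝ] ℝ} (hL : 0 ≤ L)
    (hupper : h x ≤ c)
    (hlower : ∀ l ∈ Q, c + g (l - x) - L / 2 * ‖l - x‖ ^ 2 - δ ≤ h l)
    (hD : ‖y - x‖ ≤ D) (hb : b ≤ c + g (y - x)) :
    b - h (x + a • (y - x)) ≤ (1 - a) * (b - h x) + D ^ 2 / 2 * (L * a ^ 2) + δ := by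
  have hz := hlower _ (hQ.add_smul_sub_mem hx hy ⟨ha0, ha1⟩)
  simp only [add_sub_cancel_left, map_smul, smul_eq_mul, norm_smul, Real.norm_eq_abs,
    abs_of_nonneg ha0] at hz
  have hsq : ‖y - x‖ ^ 2 ≤ D ^ 2 := pow_le_pow_left₀ (norm_nonneg _) hD 2
  have h1 := mul_le_mul_of_nonneg_left hsq (by positivity : 0 ≤ L / 2 * a ^ 2)
  have h2 := mul_le_mul_of_nonneg_left hb ha0
  have h3 := mul_le_mul_of_nonneg_left hupper (sub_nonneg.2 ha1)
  linarith


theorem frank_wolfe_bound_gap_delta_L_oracle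
    {E : Type*} [NormedAddCommGroup E] [NormedSpace ℝ E] [FiniteDimensional ℝ E]
    (Q : Set E) (hQne : Q.Nonempty) (hQcomp : IsCompact Q) (hQconv : Convex ℝ Q)
    (h : E → ℝ)
    (hstar : ℝ) (hhstar : IsGreatest (h '' Q) hstar)
    (ab : ℕ → ℝ) (hab : ∀ k, 1 ≤ k → ab k ∈ Set.Ico (0:ℝ) 1)
    (lam lamt : ℕ → E) (Bw B : ℕ → ℝ)
    (hk' : ℕ → ℝ) (gk : ℕ → E →L[ℝ] ℝ) (Lk δk : ℕ → ℝ)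
    (hLk : ∀ k, 1 ≤ k → 0 ≤ Lk k) (hδk : ∀ k, 1 ≤ k → 0 ≤ δk k)
    (hlam1 : lam 1 ∈ Q)
    (horacle1 : ∀ k, 1 ≤ k → ∀ l ∈ Q, h l ≤ hk' k + gk k (l - lam k))
    (horacle2 : ∀ k, 1 ≤ k → ∀ l ∈ Q,
      h l ≥ hk' k + gk k (l - lam k) - Lk k / 2 * ‖l - lam k‖ ^ 2 - δk k)
    (hlamtQ : ∀ k, 1 ≤ k → lamt k ∈ Q)
    (hargmax : ∀ k, 1 ≤ k → ∀ l ∈ Q, gk k (l - lam k) ≤ gk k (lamt k - lam k))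
    (hBw : ∀ k, 1 ≤ k → Bw k = hk' k + gk k (lamt k - lam k))
    (hnext : ∀ k, 1 ≤ k → lam (k+1) = lam k + ab k • (lamt k - lam k))
    (hBlb : ∀ k, hstar ≤ B k)
    (hBmono : ∀ k, 1 ≤ k → B k ≤ B (k-1))
    (hBBw : ∀ k, 1 ≤ k → B k ≤ Bw k)
    (alpha beta : ℕ → ℝ)
    (hbeta : ∀ k, 1 ≤ k → beta k = (∏ j ∈ Finset.Icc 1 (k-1), (1 - ab j))⁻¹)
    (halpha : ∀ k, 1 ≤ k → alpha k = beta k * ab k / (1 - ab k))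
    (Diam : ℝ)
    (hDiam : IsGreatest ((fun p : E × E => ‖p.1 - p.2‖) '' (Q ×ˢ Q)) Diam)
    :
    ∀ k : ℕ, B k - h (lam (k+1)) ≤ (B k - h (lam 1)) / beta (k+1)
      + (Diam ^ 2 / 2 * ∑ i ∈ Finset.Icc 1 k, Lk i * alpha i ^ 2 / beta (i+1)) / beta (k+1)
      + (∑ i ∈ Finset.Icc 1 k, beta (i+1) * δk i) / beta (k+1) := by
  have hiter : ∀ k, lam (k + 1) ∈ Q := by
    intro k
    induction k with
    | zero => exact hlam1
    | succ k ih =>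
      have hk : 1 ≤ k + 1 := by omega
      rw [hnext _ hk]
      exact hQconv.add_smul_sub_mem ih (hlamtQ _ hk) ⟨(hab _ hk).1, (hab _ hk).2.le⟩
  have hbeta_one : beta 1 = 1 := by simp [hbeta 1 le_rfl]
  have hbeta_succ : ∀ k, beta (k + 2) * (1 - ab (k + 1)) = beta (k + 1) := by
    intro k
    have hpos : 1 - ab (k + 1) ≠ 0 := by linarith [(hab (k + 1) (by omega)).2]
    rw [hbeta (k + 2) (by omega), hbeta (k + 1) (by omega),
      show k + 2 - 1 = k + 1 by omega, show k + 1 - 1 = k by omega,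
      Finset.prod_Icc_succ_top (by omega), mul_inv, mul_assoc, inv_mul_cancel₀ hpos, mul_one]
  have hbeta_ge : ∀ k, 1 ≤ beta (k + 1) := by
    intro k
    induction k with
    | zero => exact hbeta_one.ge
    | succ k ih =>
      have ha := hab (k + 1) (by omega)
      have hs := hbeta_succ k
      change 1 ≤ beta (k + 2)
      have h1 : 0 < 1 - ab (k + 1) := by linarith [ha.2]
      have h2 : 0 < beta (k + 2) := pos_of_mul_pos_left (by linarith) h1.le
      nlinarith [mul_nonneg h2.le ha.1]
  intro k
  rw [← add_div, ← add_div, le_div_iff₀ (by linarith [hbeta_ge k])]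
  induction k with
  | zero => simp [hbeta_one]
  | succ k ih =>
    have hk : 1 ≤ k + 1 := by omega
    have ha := hab _ hk
    have hb : 0 < beta (k + 2) := by linarith [hbeta_ge (k + 1)]
    have hs := hbeta_succ k
    have halpha' : alpha (k + 1) = beta (k + 2) * ab (k + 1) := by
      have hpos : 1 - ab (k + 1) ≠ 0 := by linarith [ha.2]
      rw [halpha _ hk, ← hs]
      field_simp
    have hcurv : Lk (k + 1) * alpha (k + 1) ^ 2 / beta (k + 2)
        = beta (k + 2) * (Lk (k + 1) * ab (k + 1) ^ 2) := by
      rw [halpha']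
      field_simp
    have hstep := frank_wolfe_step hQconv (hiter k) (hlamtQ _ hk) ha.1 ha.2.le (hLk _ hk)
      (by simpa using horacle1 _ hk _ (hiter k)) (horacle2 _ hk)
      (hDiam.2 ⟨(lamt (k + 1), lam (k + 1)), ⟨hlamtQ _ hk, hiter k⟩, rfl⟩)
      ((hBBw _ hk).trans_eq (hBw _ hk))
    rw [← hnext _ hk] at hstep
    have hscaled := mul_le_mul_of_nonneg_left hstep hb.le
    have hmono : B (k + 1) ≤ B k := hBmono _ hk
    have hdrop := mul_nonneg (sub_nonneg.2 (hbeta_ge k)) (sub_nonneg.2 hmono)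
    have hprev : beta (k + 2) * ((1 - ab (k + 1)) * (B (k + 1) - h (lam (k + 1))))
        = beta (k + 1) * (B (k + 1) - h (lam (k + 1))) := by
      rw [← mul_assoc, hs]
    rw [Finset.sum_Icc_succ_top hk, Finset.sum_Icc_succ_top hk]
    change (B (k + 1) - h (lam (k + 2))) * beta (k + 2) ≤ B (k + 1) - h (lam 1)
      + Diam ^ 2 / 2 * (_ + Lk (k + 1) * alpha (k + 1) ^ 2 / beta (k + 2))
      + (_ + beta (k + 2) * δk (k + 1))
    rw [hcurv]
    linarith
end

section
/- Suppose h has the minmax structure h(λ) = min_{x∈P} φ(x,λ); suppose there is an open set Q̂ ⊆ E containing Q such that φ(x,·) is differentiable on Q̂ for each fixed x ∈ P and h is differentiable on Q̂. Let λ_k ∈ Q, let λ̃_k ∈ argmax_{λ∈Q}{ h(λ_k) + ∇h(λ_k)(λ − λ_k) } and B^w_k := h(λ_k) + ∇h(λ_k)(λ̃_k − λ_k), and let x_k ∈ argmin_{x∈P} φ(x, λ_k) and B^m_k := max_{λ∈Q} φ(x_k, λ) (assuming these optima are attained). Then B^w_k ≥ B^m_k ≥ h*, where h* := max_{λ∈Q}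 h(λ). Moreover, if φ(x,·) is affine in λ for each x ∈ P, then B^w_k = B^m_k. -/
theorem hasDerivAt_comp_lineMap_zero {E : Type*} [NormedAddCommGroup E] [NormedSpace ℝ E]
    {f : E → ℝ} {f' : E →L[ℝ] ℝ} {a : E} (hf : HasFDerivAt f f' a) (b : E) :
    HasDerivAt (f ∘ AffineMap.lineMap (k := ℝ) a b) (f' (b - a)) 0 := by
  refine HasFDerivAt.comp_hasDerivAt (0 : ℝ) ?_ AffineMap.hasDerivAt_lineMap
  simpa using hf

theorem ConcaveOn.le_add_of_hasFDerivAt {E : Type*} [NormedAddCommGroup E] [NormedSpace ℝ E]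
    {s : Set E} {f : E → ℝ} {f' : E →L[ℝ] ℝ} {a b : E} (hc : ConcaveOn ℝ s f)
    (ha : a ∈ s) (hb : b ∈ s) (hf : HasFDerivAt f f' a) :
    f b ≤ f a + f' (b - a) := by
  have hslope := (hc.comp_affineMap (AffineMap.lineMap (k := ℝ) a b)).slope_le_of_hasDerivAt
    (x := 0) (y := 1) (by simpa using ha) (by simpa using hb) zero_lt_one
    (hasDerivAt_comp_lineMap_zero hf b)
  simp only [slope_def_field, Function.comp_apply, AffineMap.lineMap_apply_one,
    AffineMap.lineMap_apply_zero, sub_zero, div_one] at hslope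
  linarith

/-- Two functions differentiable at `a`, one of which minorizes the other near `a` with equality
at `a`, have the same derivative at `a`. -/
theorem fderiv_eq_of_eventually_le {E : Type*} [NormedAddCommGroup E] [NormedSpace ℝ E]
    {f g : E → ℝ} {a : E} (hf : DifferentiableAt ℝ f a) (hg : DifferentiableAt ℝ g a)
    (hle : ∀ᶠ x in nhds a, f x ≤ g x) (heq : f a = g a) :
    fderiv ℝ f a = fderiv ℝ g a := by
  have hmin : IsLocalMin (g - f) a := by
    filter_upwards [hle] with x hx
    simp only [Pi.sub_apply]
    linarith
  have hzero := hmin.hasFDerivAt_eq_zero (hg.hasFDerivAt.sub hf.hasFDerivAt)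
  exact (sub_eq_zero.mp hzero).symm

theorem wolfe_bound_dominates_minmax_bound
    {E : Type*} [NormedAddCommGroup E] [NormedSpace ℝ E] [FiniteDimensional ℝ E]
    {X : Type*} [NormedAddCommGroup X] [NormedSpace ℝ X] [FiniteDimensional ℝ X]
    (Q : Set E) (hQne : Q.Nonempty) (hQcomp : IsCompact Q) (hQconv : Convex ℝ Q)
    (P : Set X) (hPne : P.Nonempty) (hPcl : IsClosed P) (hPconv : Convex ℝ P)
    (Qhat : Set E) (hQhatopen : IsOpen Qhat) (hQQhat : Q ⊆ Qhat)
    (φ : X → E → ℝ)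
    (hφcont : ContinuousOn (fun p : X × E => φ p.1 p.2) (P ×ˢ Qhat))
    (hφconv : ∀ l ∈ Qhat, ConvexOn ℝ P (fun x => φ x l))
    (hφconc : ∀ x ∈ P, ConcaveOn ℝ Qhat (fun l => φ x l))
    (hφdiff : ∀ x ∈ P, DifferentiableOn ℝ (fun l => φ x l) Qhat)
    (h : E → ℝ) (hdiff : DifferentiableOn ℝ h Qhat)
    (hmin : ∀ l ∈ Qhat, IsLeast ((fun x => φ x l) '' P) (h l))
    (hstar : ℝ) (hhstar : IsGreatest (h '' Q) hstar)
    (lamk : E) (hlamk : lamk ∈ Q)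
    (lamtk : E) (hlamtk : lamtk ∈ Q)
    (hargmax : ∀ l ∈ Q,
      (fderiv ℝ h lamk) (l - lamk) ≤ (fderiv ℝ h lamk) (lamtk - lamk))
    (Bwk : ℝ) (hBwk : Bwk = h lamk + (fderiv ℝ h lamk) (lamtk - lamk))
    (xk : X) (hxk : xk ∈ P) (hxkmin : ∀ x ∈ P, φ xk lamk ≤ φ x lamk)
    (Bmk : ℝ) (hBmk : IsGreatest ((fun l => φ xk l) '' Q) Bmk)
    :
    Bmk ≤ Bwk ∧ hstar ≤ Bmk ∧
      ((∀ x ∈ P, ∀ l l' : E, ∀ t : ℝ,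
          φ x ((1 - t) • l + t • l') = (1 - t) * φ x l + t * φ x l') →
        Bwk = Bmk) := by
  have hlamk' := hQQhat hlamk
  have hnhds : Qhat ∈ nhds lamk := hQhatopen.mem_nhds hlamk'
  have hval : h lamk = φ xk lamk := by
    obtain ⟨⟨x, hx, hxeq⟩, hlow⟩ := hmin lamk hlamk'
    exact le_antisymm (hlow ⟨xk, hxk, rfl⟩) (hxeq ▸ hxkmin x hx)
  have hle : ∀ l ∈ Qhat, h l ≤ φ xk l := fun l hl => (hmin l hl).2 ⟨xk, hxk, rfl⟩
  have hφat : DifferentiableAt ℝ (fun l => φ xk l) lamk :=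
    (hφdiff xk hxk).differentiableAt hnhds
  have hfderiv : fderiv ℝ h lamk = fderiv ℝ (fun l => φ xk l) lamk :=
    fderiv_eq_of_eventually_le (hdiff.differentiableAt hnhds) hφat
      (Filter.mem_of_superset hnhds hle) hval
  have hφfderiv : HasFDerivAt (fun l => φ xk l) (fderiv ℝ h lamk) lamk :=
    hfderiv ▸ hφat.hasFDerivAt
  have hBm_le : Bmk ≤ Bwk := by
    obtain ⟨l, hl, rfl⟩ := hBmk.1
    have htangent := (hφconc xk hxk).le_add_of_hasFDerivAt hlamk' (hQQhat hl) hφfderiv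
    have hmax := hargmax l hl
    dsimp only at htangent ⊢
    linarith
  refine ⟨hBm_le, ?_, fun haff => le_antisymm ?_ hBm_le⟩
  · obtain ⟨l, hl, rfl⟩ := hhstar.1
    exact (hle l (hQQhat hl)).trans (hBmk.2 ⟨l, hl, rfl⟩)
  · have hline : (fun l => φ xk l) ∘ AffineMap.lineMap (k := ℝ) lamk lamtk =
        AffineMap.lineMap (k := ℝ) (φ xk lamk) (φ xk lamtk) := by
      ext t
      simp only [Function.comp_apply, AffineMap.lineMap_apply_module, haff xk hxk, smul_eq_mul]
    have hderiv := hasDerivAt_comp_lineMap_zero hφfderiv lamtk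
    rw [hline] at hderiv
    have hslope := hderiv.unique AffineMap.hasDerivAt_lineMap
    have hBm : φ xk lamtk ≤ Bmk := hBmk.2 ⟨lamtk, hlamtk, rfl⟩
    linarith
end
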